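/- arXiv:2409.04263 — 5 statements merged into one kernel-verified Lean document; each statement's English description precedes it below -/
import Mathlib

section
/- For every finite set X ⊂ ℝᵈ of pairwise distinct points with separation distance q_X, every R ≥ π/q_X, every x₀ ∈ ℝᵈ and every α ∈ ℝ^{|X|}, one has ∫_{B_R(x₀)} |Σ_j α_j e^{i ωᵀx_j}|² dω ≤ c₂ Rᵈ ‖α‖², where c₂ > 0 depends only on d. -/
open MeasureTheory
open scoped InnerProductSpace

lemma gauss_int (d : ℕ) (b : ℝ) (hb : 0 < b) :
    Integrable (fun z : EuclideanSpace ℝ (Fin d) => Real.exp (-b * ‖z‖ ^ 2)) := by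
  have h := (GaussianFourier.integrable_cexp_neg_mul_sq_norm_add (V := EuclideanSpace ℝ (Fin d))
    (b := (b : ℂ)) (by simpa using hb) 0 0).norm
  refine h.congr (Filter.Eventually.of_forall fun z => ?_)
  simp [Complex.norm_exp, ← Complex.ofReal_pow]

lemma pack (d : ℕ) : ∃ C : ℝ, 0 < C ∧ ∀ (n : ℕ) (y : Fin n → EuclideanSpace ℝ (Fin d)),
    (∀ i j, i ≠ j → 2 ≤ dist (y i) (y j)) → ∑ k, Real.exp (-(‖y k‖ ^ 2) / 4) ≤ C := by
  set f : EuclideanSpace ℝ (Fin d) → ℝ := fun z => Real.exp (-(1/8) * ‖z‖ ^ 2) with hf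
  have hfi : Integrable f := gauss_int d (1/8) (by norm_num)
  set v : ℝ := (volume : Measure (EuclideanSpace ℝ (Fin d))).real (Metric.ball 0 1) with hv
  have hv0 : 0 < v := ENNReal.toReal_pos (Metric.measure_ball_pos _ _ one_pos).ne'
    measure_ball_lt_top.ne
  have hI : 0 ≤ ∫ z, f z := integral_nonneg fun z => (Real.exp_pos _).le
  refine ⟨(∫ z, f z) * Real.exp (1/4) / v + 1, by positivity, fun n y hy => ?_⟩
  have key : ∀ k, Real.exp (-(‖y k‖ ^ 2) / 4) * (v * Real.exp (-(1/4))) ≤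
      ∫ z in Metric.ball (y k) 1, f z := by
    intro k
    have h1 : ∫ z in Metric.ball (y k) 1, (Real.exp (-(‖y k‖ ^ 2) / 4) * Real.exp (-(1/4))) ≤
        ∫ z in Metric.ball (y k) 1, f z := by
      refine setIntegral_mono_on (integrableOn_const measure_ball_lt_top.ne) hfi.integrableOn
        measurableSet_ball fun z hz => ?_
      rw [← Real.exp_add]
      apply Real.exp_le_exp.2
      have h2 : ‖z‖ ≤ ‖y k‖ + 1 := by
        have := norm_le_norm_add_norm_sub' z (y k)
        rw [mem_ball_iff_norm] at hz
        linarith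
      have h3 : ‖z‖ ^ 2 ≤ (‖y k‖ + 1) ^ 2 := pow_le_pow_left₀ (norm_nonneg _) h2 2
      nlinarith [sq_nonneg (‖y k‖ - 1)]
    have h4 : (volume : Measure (EuclideanSpace ℝ (Fin d))).real (Metric.ball (y k) 1) = v := by
      simp only [hv, Measure.real, Measure.addHaar_ball_center _ (y k)]
    rw [setIntegral_const, h4, smul_eq_mul] at h1
    linarith
  have hs : ∑ k, ∫ z in Metric.ball (y k) 1, f z ≤ ∫ z, f z := by
    rw [← integral_biUnion_finset Finset.univ (fun i _ => measurableSet_ball) ?_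
      (fun i _ => hfi.integrableOn)]
    · exact setIntegral_le_integral hfi (Filter.Eventually.of_forall fun z => (Real.exp_pos _).le)
    · intro i _ j _ hij
      apply Metric.ball_disjoint_ball
      have := hy i j hij
      linarith
  have h5 := (Finset.sum_le_sum fun k (_ : k ∈ Finset.univ) => key k).trans hs
  rw [← Finset.sum_mul] at h5
  have h6 : Real.exp (-(1/4)) * Real.exp (1/4) = 1 := by rw [← Real.exp_add]; simp
  have : ∑ k, Real.exp (-(‖y k‖ ^ 2) / 4) ≤ (∫ z, f z) * Real.exp (1/4) / v := by
    rw [le_div_iff₀ hv0]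
    have := mul_le_mul_of_nonneg_right h5 (Real.exp_pos (1/4)).le
    calc _ = (∑ k, Real.exp (-(‖y k‖ ^ 2) / 4)) * v * (Real.exp (-(1/4)) * Real.exp (1/4)) := by
            rw [h6, mul_one]
      _ ≤ _ := by linarith
  linarith

lemma gaussF (d : ℕ) (R : ℝ) (hR : 0 < R) (w : EuclideanSpace ℝ (Fin d)) :
    ‖∫ v : EuclideanSpace ℝ (Fin d),
      Complex.exp (-((1 / R ^ 2 : ℝ) : ℂ) * (‖v‖ : ℂ) ^ 2 + Complex.I * ((⟪w, v⟫_ℝ : ℝ) : ℂ))‖ =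
    Real.pi ^ ((d : ℝ) / 2) * R ^ d * Real.exp (-(‖R • w‖ ^ 2) / 4) := by
  have hb : 0 < 1 / R ^ 2 := by positivity
  rw [GaussianFourier.integral_cexp_neg_mul_sq_norm_add (by rw [Complex.ofReal_re]; exact hb)]
  rw [norm_mul, Complex.norm_exp]
  have e1 : ((Real.pi : ℂ) / ((1 / R ^ 2 : ℝ) : ℂ)) = ((Real.pi * R ^ 2 : ℝ) : ℂ) := by
    push_cast; field_simp
  have e2 : (Complex.I ^ 2 * (‖w‖ : ℂ) ^ 2 / (4 * ((1 / R ^ 2 : ℝ) : ℂ))) =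
      ((-(‖R • w‖ ^ 2) / 4 : ℝ) : ℂ) := by
    rw [norm_smul, Real.norm_of_nonneg hR.le]
    have : (R : ℂ) ≠ 0 := by exact_mod_cast hR.ne'
    push_cast; rw [Complex.I_sq]; field_simp
  rw [e1, e2, Complex.norm_cpow_eq_rpow_re_of_pos (by positivity), Complex.ofReal_re]
  congr 1
  have : ((Module.finrank ℝ (EuclideanSpace ℝ (Fin d)) : ℂ) / 2).re = (d : ℝ) / 2 := by
    simp
  rw [this, Real.mul_rpow Real.pi_pos.le (by positivity), ← Real.rpow_natCast R 2,
    ← Real.rpow_mul hR.le, ← Real.rpow_natCast R d]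
  congr 2
  push_cast; ring

lemma centered (d : ℕ) : ∃ c : ℝ, 0 < c ∧ ∀ (n : ℕ) (x : Fin n → EuclideanSpace ℝ (Fin d))
    (R : ℝ) (β : Fin n → ℂ), 0 < R → (∀ i j, i ≠ j → 2 ≤ R * dist (x i) (x j)) →
    (∫ ω in Metric.ball (0 : EuclideanSpace ℝ (Fin d)) R,
      ‖∑ j, β j * Complex.exp (Complex.I * ((⟪ω, x j⟫_ℝ : ℝ) : ℂ))‖ ^ 2) ≤
      c * R ^ d * ∑ j, ‖β j‖ ^ 2 := by
  obtain ⟨C, hC, hpack⟩ := pack d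
  set P : ℝ := Real.pi ^ ((d : ℝ) / 2) with hP
  have hP0 : 0 < P := Real.rpow_pos_of_pos Real.pi_pos _
  refine ⟨Real.exp 1 * P * C, by positivity, fun n x R β hR hx => ?_⟩
  have hb : 0 < 1 / R ^ 2 := by positivity
  set S : EuclideanSpace ℝ (Fin d) → ℂ :=
    fun ω => ∑ j, β j * Complex.exp (Complex.I * ((⟪ω, x j⟫_ℝ : ℝ) : ℂ)) with hS
  set G : EuclideanSpace ℝ (Fin d) → EuclideanSpace ℝ (Fin d) → ℂ := fun w v =>
    Complex.exp (-((1 / R ^ 2 : ℝ) : ℂ) * (‖v‖ : ℂ) ^ 2 + Complex.I * ((⟪w, v⟫_ℝ : ℝ) : ℂ)) with hG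
  have hGi : ∀ w, Integrable (G w) := fun w =>
    GaussianFourier.integrable_cexp_neg_mul_sq_norm_add (by rw [Complex.ofReal_re]; exact hb) _ _
  have expand : ∀ ω, ((Real.exp (-(1 / R ^ 2) * ‖ω‖ ^ 2) * ‖S ω‖ ^ 2 : ℝ) : ℂ) =
      ∑ j, ∑ k, β j * (starRingEnd ℂ) (β k) * G (x j - x k) ω := by
    intro ω
    push_cast
    rw [← Complex.mul_conj', hS]
    simp only [map_sum]
    rw [Finset.sum_mul_sum]
    simp only [Finset.mul_sum]
    refine Finset.sum_congr rfl fun j _ => Finset.sum_congr rfl fun k _ => ?_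
    rw [map_mul, ← Complex.exp_conj, map_mul, Complex.conj_I, Complex.conj_ofReal, hG]
    simp only [real_inner_comm ω, inner_sub_right]
    rw [show -((1 / R ^ 2 : ℝ) : ℂ) * (‖ω‖ : ℂ) ^ 2 +
        Complex.I * ((⟪ω, x j⟫_ℝ - ⟪ω, x k⟫_ℝ : ℝ) : ℂ) =
      -(1 / (R : ℂ) ^ 2) * (‖ω‖ : ℂ) ^ 2 + Complex.I * ((⟪ω, x j⟫_ℝ : ℝ) : ℂ) +
        -Complex.I * ((⟪ω, x k⟫_ℝ : ℝ) : ℂ) by push_cast; ring, Complex.exp_add, Complex.exp_add]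
    ring
  have hIc : Integrable (fun ω => ((Real.exp (-(1 / R ^ 2) * ‖ω‖ ^ 2) * ‖S ω‖ ^ 2 : ℝ) : ℂ)) := by
    simp only [expand]
    exact integrable_finsetSum _ fun j _ => integrable_finsetSum _ fun k _ =>
      (hGi _).const_mul _
  have hIr : Integrable (fun ω => Real.exp (-(1 / R ^ 2) * ‖ω‖ ^ 2) * ‖S ω‖ ^ 2) := by
    exact hIc.re
  have hScont : Continuous S := by fun_prop
  -- step 1
  have s1 : (∫ ω in Metric.ball (0 : EuclideanSpace ℝ (Fin d)) R, ‖S ω‖ ^ 2) ≤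
      Real.exp 1 * ∫ ω, Real.exp (-(1 / R ^ 2) * ‖ω‖ ^ 2) * ‖S ω‖ ^ 2 := by
    rw [← integral_const_mul]
    refine le_trans (setIntegral_mono_on ?_ (hIr.const_mul _).integrableOn measurableSet_ball
      (g := fun ω => Real.exp 1 * (Real.exp (-(1 / R ^ 2) * ‖ω‖ ^ 2) * ‖S ω‖ ^ 2)) ?_)
      (setIntegral_le_integral (hIr.const_mul _) (Filter.Eventually.of_forall fun z => ?_))
    · exact ((hScont.norm.pow 2).continuousOn.integrableOn_compact
        (isCompact_closedBall 0 R)).mono_set Metric.ball_subset_closedBall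
    · intro ω hω
      rw [mem_ball_zero_iff] at hω
      rw [← mul_assoc, ← Real.exp_add]
      refine le_mul_of_one_le_left (by positivity) (Real.one_le_exp ?_)
      have : ‖ω‖ ^ 2 ≤ R ^ 2 := pow_le_pow_left₀ (norm_nonneg _) hω.le 2
      have h2 : 1 / R ^ 2 * ‖ω‖ ^ 2 ≤ 1 := by
        rw [one_div_mul_eq_div]; exact (div_le_one (by positivity)).2 this
      linarith
    · show 0 ≤ _
      positivity
  -- step 2
  set E : Fin n → Fin n → ℝ := fun j k => Real.exp (-(‖R • (x j - x k)‖ ^ 2) / 4) with hE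
  have s2 : ∫ ω, Real.exp (-(1 / R ^ 2) * ‖ω‖ ^ 2) * ‖S ω‖ ^ 2 ≤
      ∑ j, ∑ k, ‖β j‖ * ‖β k‖ * (P * R ^ d * E j k) := by
    refine (Real.le_norm_self _).trans ?_
    rw [← Complex.norm_real, ← integral_complex_ofReal]
    simp only [expand]
    rw [integral_finsetSum _ fun j _ => integrable_finsetSum _ fun k _ => (hGi _).const_mul _]
    refine (norm_sum_le _ _).trans (Finset.sum_le_sum fun j _ => ?_)
    rw [integral_finsetSum _ fun k _ => (hGi _).const_mul _]
    refine (norm_sum_le _ _).trans (Finset.sum_le_sum fun k _ => ?_)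
    rw [integral_const_mul, norm_mul, norm_mul, RCLike.norm_conj, gaussF d R hR]
  have hrow : ∀ j, ∑ k, E j k ≤ C := fun j => by
    refine hpack n (fun k => R • (x j - x k)) fun i k hik => ?_
    have := hx i k hik
    rw [dist_eq_norm, ← smul_sub, norm_smul, Real.norm_of_nonneg hR.le]
    rw [sub_sub_sub_cancel_left, ← dist_eq_norm, dist_comm]
    exact this
  have hsymm : ∀ j k, E j k = E k j := fun j k => by
    simp only [hE, norm_smul, norm_sub_rev (x j)]
  have s3 : ∑ j, ∑ k, ‖β j‖ * ‖β k‖ * E j k ≤ C * ∑ j, ‖β j‖ ^ 2 := by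
    have a1 : ∑ j, ∑ k, ‖β j‖ * ‖β k‖ * E j k ≤
        ∑ j, ∑ k, (‖β j‖ ^ 2 * E j k / 2 + ‖β k‖ ^ 2 * E k j / 2) := by
      refine Finset.sum_le_sum fun j _ => Finset.sum_le_sum fun k _ => ?_
      rw [hsymm k j]
      have : 0 ≤ E j k := (Real.exp_pos _).le
      nlinarith [mul_nonneg this (sq_nonneg (‖β j‖ - ‖β k‖))]
    have a2 : ∑ j, ∑ k, ‖β j‖ ^ 2 * E j k / 2 ≤ C * (∑ j, ‖β j‖ ^ 2) / 2 := by
      rw [Finset.mul_sum, Finset.sum_div]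
      refine Finset.sum_le_sum fun j _ => ?_
      rw [← Finset.sum_div, ← Finset.mul_sum]
      nlinarith [mul_le_mul_of_nonneg_left (hrow j) (sq_nonneg ‖β j‖)]
    simp only [Finset.sum_add_distrib] at a1
    rw [Finset.sum_comm (f := fun j k => ‖β k‖ ^ 2 * E k j / 2)] at a1
    linarith
  have s4 : ∑ j, ∑ k, ‖β j‖ * ‖β k‖ * (P * R ^ d * E j k) =
      P * R ^ d * ∑ j, ∑ k, ‖β j‖ * ‖β k‖ * E j k := by
    simp only [Finset.mul_sum]
    refine Finset.sum_congr rfl fun j _ => Finset.sum_congr rfl fun k _ => ?_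
    ring
  rw [s4] at s2
  calc _ ≤ _ := s1
    _ ≤ Real.exp 1 * (P * R ^ d * (C * ∑ j, ‖β j‖ ^ 2)) := by
      refine mul_le_mul_of_nonneg_left (s2.trans ?_) (Real.exp_pos _).le
      exact mul_le_mul_of_nonneg_left s3 (by positivity)
    _ = _ := by ring

/-- Upper Ingham-type bound: for `R ≥ π / q_X`, the `L²(B_R(x₀))` mass of an
exponential sum is at most `c₂ R^d ‖α‖²`, with `c₂` depending only on `d`. -/
theorem stmt_4 (d : ℕ) :
    ∃ c₂ : ℝ, 0 < c₂ ∧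
      ∀ (n : ℕ) (x : Fin n → EuclideanSpace ℝ (Fin d)), Function.Injective x →
        ∀ qX : ℝ, IsLeast {r | ∃ i j, i ≠ j ∧ r = dist (x i) (x j)} qX →
        ∀ (R : ℝ) (x₀ : EuclideanSpace ℝ (Fin d)) (α : Fin n → ℝ),
          Real.pi / qX ≤ R →
          (∫ ω in Metric.ball x₀ R,
              ‖∑ j, (α j : ℂ) * Complex.exp (Complex.I * ((⟪ω, x j⟫_ℝ : ℝ) : ℂ))‖ ^ 2) ≤
            c₂ * R ^ d * ∑ j, α j ^ 2 := by
  obtain ⟨c, hc, h⟩ := centered d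
  refine ⟨c, hc, fun n x hinj qX hq R x₀ α hR => ?_⟩
  have hq0 : 0 < qX := by
    obtain ⟨i, j, hij, rfl⟩ := hq.1
    exact dist_pos.2 (hinj.ne hij)
  have hR0 : 0 < R := (div_pos Real.pi_pos hq0).trans_le hR
  have hsep : ∀ i j, i ≠ j → 2 ≤ R * dist (x i) (x j) := fun i j hij => by
    have h1 : qX ≤ dist (x i) (x j) := hq.2 ⟨i, j, hij, rfl⟩
    have h2 : Real.pi ≤ R * qX := (div_le_iff₀ hq0).1 hR
    nlinarith [Real.two_le_pi]
  have := h n x R (fun j => (α j : ℂ) * Complex.exp (Complex.I * ((⟪x₀, x j⟫_ℝ : ℝ) : ℂ))) hR0 hsep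
  have e1 : ∀ j, ‖(α j : ℂ) * Complex.exp (Complex.I * ((⟪x₀, x j⟫_ℝ : ℝ) : ℂ))‖ ^ 2 = α j ^ 2 := by
    intro j
    rw [norm_mul, mul_comm Complex.I, Complex.norm_exp_ofReal_mul_I, mul_one, Complex.norm_real,
      Real.norm_eq_abs, sq_abs]
  simp only [e1] at this
  refine le_of_eq_of_le ?_ this
  have mp := measurePreserving_add_left (volume : Measure (EuclideanSpace ℝ (Fin d))) x₀
  rw [← mp.setIntegral_preimage_emb (MeasurableEquiv.addLeft x₀).measurableEmbedding]
  have hpre : (fun y => x₀ + y) ⁻¹' Metric.ball x₀ R = Metric.ball 0 R := by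
    ext y; simp
  rw [hpre]
  congr 1
  ext y
  congr 2
  refine Finset.sum_congr rfl fun j _ => ?_
  rw [inner_add_left, Complex.ofReal_add, mul_add, Complex.exp_add, mul_assoc]
end

section
/- For every finite set X ⊂ ℝᵈ of pairwise distinct points with separation distance q_X, every R ≥ √2 λ_min(−Δ)^{1/2}/q_X and every α ∈ ℝ^{|X|}, one has π^{d/2}/(2 λ_min(−Δ)^{d/2}) · Rᵈ ‖α‖² ≤ ∫_{B_R(0)} |Σ_j α_j e^{i ωᵀx_j}|² dω, where λ_min(−Δ) is the smallest Dirichlet Laplace eigenvalue on B_{1/2}(0) ⊂ ℝᵈ. -/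
open MeasureTheory
open scoped InnerProductSpace

/-- The smallest eigenvalue of the Dirichlet Laplace operator on the ball
`B_{1/2}(0) ⊂ ℝ^d`, via its variational (Rayleigh quotient) characterization. -/
noncomputable def dirichletLambdaMin (d : ℕ) : ℝ :=
  ⨅ u : {u : EuclideanSpace ℝ (Fin d) → ℝ //
      ContDiff ℝ 2 u ∧ tsupport u ⊆ Metric.ball 0 (1 / 2) ∧ (∫ x, u x ^ 2) ≠ 0},
    (∫ x, ‖fderiv ℝ u.1 x‖ ^ 2) / ∫ x, u.1 x ^ 2

open scoped FourierTransform SchwartzMap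

lemma plancherel_aux {d : ℕ} (f : EuclideanSpace ℝ (Fin d) → ℂ) (hf : Continuous f)
    (hc : HasCompactSupport f) :
    Integrable (fun w => ‖𝓕 f w‖ ^ 2) ∧ ∫ w, ‖𝓕 f w‖ ^ 2 = ∫ x, ‖f x‖ ^ 2 := by
  have hint : Integrable f := hf.integrable_of_hasCompactSupport hc
  have hL2 : MemLp f 2 := hf.memLp_of_hasCompactSupport hc
  set g : Lp ℂ 2 (volume : Measure (EuclideanSpace ℝ (Fin d))) := hL2.toLp f with hg
  have hFc : Continuous (𝓕 f) :=
    VectorFourier.fourierIntegral_continuous Real.continuous_fourierChar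
      (L := innerₗ (EuclideanSpace ℝ (Fin d))) continuous_inner hint
  have hae : ∀ᵐ x, (𝓕 g : Lp ℂ 2 (volume : Measure (EuclideanSpace ℝ (Fin d)))) x = 𝓕 f x := by
    apply ae_eq_of_integral_contDiff_smul_eq
    · exact (Lp.memLp _).locallyIntegrable (by norm_num)
    · exact hFc.locallyIntegrable
    · intro φ hφ hφc
      have hg₁ : HasCompactSupport (Complex.ofRealCLM ∘ φ) := hφc.comp_left rfl
      have hg₂ : ContDiff ℝ ((⊤ : ℕ∞) : WithTop ℕ∞) (Complex.ofRealCLM ∘ φ) := by fun_prop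
      set ψ : 𝓢(EuclideanSpace ℝ (Fin d), ℂ) := hg₁.toSchwartzMap hg₂ with hψ
      have h1 := congrArg (fun T => T ψ) (Lp.fourier_toTemperedDistribution_eq g)
      simp only [TemperedDistribution.fourier_apply, Lp.toTemperedDistribution_apply] at h1
      have h2 : ∫ x, (𝓕 ψ) x • g x = ∫ x, (𝓕 ψ) x • f x := by
        apply integral_congr_ae
        filter_upwards [hL2.coeFn_toLp] with x hx
        rw [hx]
      have h3 : ∫ ξ, (𝓕 ψ ξ) • f ξ = ∫ x, ψ x • 𝓕 f x := by
        simpa using! VectorFourier.integral_bilin_fourierIntegral_eq_flip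
          (ContinuousLinearMap.lsmul ℂ ℂ) (L := innerₗ (EuclideanSpace ℝ (Fin d)))
          Real.continuous_fourierChar continuous_inner ψ.integrable hint
      have h4 := h1.symm.trans (h2.trans h3)
      simpa [hψ] using h4
  have hmem : MemLp (𝓕 f) 2 := (memLp_congr_ae hae).1 (Lp.memLp _)
  refine ⟨(memLp_two_iff_integrable_sq_norm hFc.aestronglyMeasurable).1 hmem, ?_⟩
  have key : ∀ h : Lp ℂ 2 (volume : Measure (EuclideanSpace ℝ (Fin d))), ‖h‖ ^ 2 = ∫ x, ‖h x‖ ^ 2 := by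
    intro h
    have := L2.inner_def (𝕜 := ℂ) h h
    rw [inner_self_eq_norm_sq_to_K] at this
    have h2 : (∫ x, ⟪h x, h x⟫_ℂ) = ((∫ x, ‖h x‖ ^ 2 : ℝ) : ℂ) := by
      rw [← integral_complex_ofReal]
      congr 1; ext x
      rw [inner_self_eq_norm_sq_to_K]; simp
    rw [h2] at this
    exact Complex.ofReal_injective (by push_cast; simpa using this)
  calc ∫ w, ‖𝓕 f w‖ ^ 2 = ∫ w, ‖(𝓕 g : Lp ℂ 2 (volume : Measure (EuclideanSpace ℝ (Fin d)))) w‖ ^ 2 := by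
        apply integral_congr_ae
        filter_upwards [hae] with x hx
        rw [hx]
    _ = ‖g‖ ^ 2 := by rw [← key, Lp.norm_fourier_eq]
    _ = ∫ x, ‖f x‖ ^ 2 := by
        rw [key]
        apply integral_congr_ae
        filter_upwards [hL2.coeFn_toLp] with x hx
        rw [hx]


lemma plancherel_deriv {d : ℕ} (F : EuclideanSpace ℝ (Fin d) → ℝ) (hF : ContDiff ℝ 1 F)
    (hc : HasCompactSupport F) :
    Integrable (fun w => (2 * Real.pi * ‖w‖) ^ 2 * ‖𝓕 (fun x => (F x : ℂ)) w‖ ^ 2) ∧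
    ∫ w, (2 * Real.pi * ‖w‖) ^ 2 * ‖𝓕 (fun x => (F x : ℂ)) w‖ ^ 2 = ∫ x, ‖fderiv ℝ F x‖ ^ 2 := by
  set f : EuclideanSpace ℝ (Fin d) → ℂ := fun x => (F x : ℂ) with hf
  have hfd : ContDiff ℝ 1 f := Complex.ofRealCLM.contDiff.comp hF
  have hfc : HasCompactSupport f := hc.comp_left (g := ((↑) : ℝ → ℂ)) (by simp)
  have hfdc : Continuous (fderiv ℝ f) := hfd.continuous_fderiv (by norm_num)
  have hfds : HasCompactSupport (fderiv ℝ f) := hfc.fderiv ℝ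
  have hff := Real.fourier_fderiv (hfd.continuous.integrable_of_hasCompactSupport hfc)
    (hfd.differentiable (by norm_num)) (hfdc.integrable_of_hasCompactSupport hfds)
  have hderiv : ∀ x m, fderiv ℝ f x m = ((fderiv ℝ F x m : ℝ) : ℂ) := by
    intro x m
    have h1 : HasFDerivAt F (fderiv ℝ F x) x := (hF.differentiable (by norm_num) x).hasFDerivAt
    have h2 : HasFDerivAt f (Complex.ofRealCLM.comp (fderiv ℝ F x)) x :=
      Complex.ofRealCLM.hasFDerivAt.comp x h1
    rw [h2.fderiv]; simp
  let e := EuclideanSpace.basisFun (Fin d) ℝ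
  have hP : ∀ i, Integrable (fun w => (2 * Real.pi * (w i)) ^ 2 * ‖𝓕 f w‖ ^ 2) ∧
      ∫ w, (2 * Real.pi * (w i)) ^ 2 * ‖𝓕 f w‖ ^ 2 = ∫ x, (fderiv ℝ F x (e i)) ^ 2 := by
    intro i
    have h := plancherel_aux (fun x => fderiv ℝ f x (e i)) (by fun_prop)
      (hfds.comp_left (g := fun L : EuclideanSpace ℝ (Fin d) →L[ℝ] ℂ => L (e i)) (by simp))
    have h3 : ∀ w, ‖𝓕 (fun x => fderiv ℝ f x (e i)) w‖ ^ 2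
        = (2 * Real.pi * (w i)) ^ 2 * ‖𝓕 f w‖ ^ 2 := by
      intro w
      have h4 : 𝓕 (fun x => fderiv ℝ f x (e i)) w = (𝓕 (fderiv ℝ f) w) (e i) :=
        (Real.fourier_continuousLinearMap_apply
          (hfdc.integrable_of_hasCompactSupport hfds)).symm
      rw [h4, hff, VectorFourier.fourierSMulRight_apply]
      have h5 : (innerSL ℝ w) (EuclideanSpace.single i (1 : ℝ)) = w i := by
        rw [innerSL_apply_apply, EuclideanSpace.inner_single_right]; simp
      simp [e, mul_pow, h5]
      ring
    simp only [h3] at h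
    refine ⟨h.1, h.2.trans ?_⟩
    congr 1; ext x
    rw [hderiv]; simp
  have hsum : ∀ w : EuclideanSpace ℝ (Fin d), (2 * Real.pi * ‖w‖) ^ 2 * ‖𝓕 f w‖ ^ 2
      = ∑ i, (2 * Real.pi * (w i)) ^ 2 * ‖𝓕 f w‖ ^ 2 := by
    intro w
    rw [mul_pow, EuclideanSpace.norm_sq_eq, Finset.mul_sum, Finset.sum_mul]
    simp [mul_pow]
  have hsum2 : ∀ x, ‖fderiv ℝ F x‖ ^ 2 = ∑ i, (fderiv ℝ F x (e i)) ^ 2 := by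
    intro x
    set L := fderiv ℝ F x
    rw [← (InnerProductSpace.toDual ℝ _).symm.norm_map L, ← e.sum_sq_norm_inner_left]
    simp
  simp only [hsum, hsum2]
  refine ⟨integrable_finsetSum _ fun i _ => (hP i).1, ?_⟩
  rw [integral_finsetSum _ fun i _ => (hP i).1, integral_finsetSum]
  · exact Finset.sum_congr rfl fun i _ => (hP i).2
  · intro i _
    have hc1 : Continuous (fderiv ℝ F) := hF.continuous_fderiv (by norm_num)
    apply Continuous.integrable_of_hasCompactSupport (by fun_prop)
    exact (hc.fderiv ℝ).comp_left
      (g := fun L : EuclideanSpace ℝ (Fin d) →L[ℝ] ℝ => (L (e i)) ^ 2) (by simp)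

lemma vol_ball {d : ℕ} (s : ℝ) (hs : 0 < s) :
    (volume (Metric.ball (0 : EuclideanSpace ℝ (Fin d)) (s / 2))).toReal ≤ s ^ d := by
  have h : Metric.ball (0 : EuclideanSpace ℝ (Fin d)) (s / 2) ⊆
      (MeasurableEquiv.toLp 2 (Fin d → ℝ)).symm ⁻¹'
        (Set.pi Set.univ fun _ => Set.Icc (-(s/2)) (s/2)) := by
    intro x hx
    simp only [Metric.mem_ball, dist_zero_right] at hx
    intro i _
    have := (PiLp.norm_apply_le x i).trans hx.le
    exact abs_le.1 this
  have h2 := measure_mono (μ := volume) h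
  rw [(EuclideanSpace.volume_preserving_symm_measurableEquiv_toLp (Fin d)).measure_preimage
    (MeasurableSet.univ_pi fun _ => measurableSet_Icc).nullMeasurableSet, volume_pi_pi] at h2
  have h3 : s / 2 - -(s / 2) = s := by ring
  simp only [Real.volume_Icc, h3, Finset.prod_const, Finset.card_univ, Fintype.card_fin,
    ← ENNReal.ofReal_pow hs.le] at h2
  exact ENNReal.toReal_le_of_le_ofReal (by positivity) h2

lemma integrable_comp_aux {d : ℕ} {EE : Type*} [NormedAddCommGroup EE]
    (v : EuclideanSpace ℝ (Fin d) → EE) (hv : Continuous v)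
    (hc : HasCompactSupport v) (g : EE → ℝ) (hg : Continuous g) (h0 : g 0 = 0) :
    Integrable (fun x => g (v x)) := by
  have h : HasCompactSupport (g ∘ v) := hc.comp_left h0
  exact (hg.comp hv).integrable_of_hasCompactSupport h

lemma norm_sq_sum_aux {n : ℕ} {EE : Type*} [NormedAddCommGroup EE] [NormedSpace ℝ EE]
    (a : Fin n → ℝ) (g : Fin n → EE) (h : ∀ i j, i ≠ j → g i = 0 ∨ g j = 0) :
    ‖∑ j, a j • g j‖ ^ 2 = ∑ j, a j ^ 2 * ‖g j‖ ^ 2 := by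
  by_cases h0 : ∃ i, g i ≠ 0
  · obtain ⟨i, hi⟩ := h0
    have hz : ∀ j, j ≠ i → g j = 0 := fun j hj => (h j i hj).resolve_right hi
    rw [Finset.sum_eq_single i (fun j _ hj => by simp [hz j hj]) (by simp),
      Finset.sum_eq_single i (fun j _ hj => by simp [hz j hj]) (by simp), norm_smul, mul_pow,
      Real.norm_eq_abs, sq_abs]
  · push Not at h0
    simp [h0]

lemma integral_norm_sq_sum {n d : ℕ} {EE : Type*} [NormedAddCommGroup EE] [NormedSpace ℝ EE]
    (x : Fin n → EuclideanSpace ℝ (Fin d)) (a : Fin n → ℝ) (s : ℝ)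
    (hx : ∀ i j, i ≠ j → s ≤ dist (x i) (x j))
    (g : EuclideanSpace ℝ (Fin d) → EE) (hg : Continuous g) (hc : HasCompactSupport g)
    (hsup : ∀ y, y ∉ Metric.ball 0 (s / 2) → g y = 0) :
    ∫ y, ‖∑ j, a j • g (y + x j)‖ ^ 2 = (∑ j, a j ^ 2) * ∫ y, ‖g y‖ ^ 2 := by
  have h1 : ∀ y, ‖∑ j, a j • g (y + x j)‖ ^ 2 = ∑ j, a j ^ 2 * ‖g (y + x j)‖ ^ 2 := by
    intro y
    apply norm_sq_sum_aux a (fun j => g (y + x j))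
    intro i j hij
    by_contra! hcon
    have hi : y + x i ∈ Metric.ball 0 (s / 2) := by
      by_contra h; exact hcon.1 (hsup _ h)
    have hj : y + x j ∈ Metric.ball 0 (s / 2) := by
      by_contra h; exact hcon.2 (hsup _ h)
    have h3 := dist_triangle_right (y + x i) (y + x j) 0
    rw [dist_add_left] at h3
    have := hx i j hij
    rw [Metric.mem_ball] at hi hj
    linarith
  have hI : Integrable (fun y => ‖g y‖ ^ 2) :=
    integrable_comp_aux g hg hc (fun t => ‖t‖ ^ 2) (by fun_prop) (by simp)
  simp only [h1]
  rw [integral_finsetSum _ fun j _ => (hI.comp_add_right (x j)).const_mul _, Finset.sum_mul]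
  refine Finset.sum_congr rfl fun j _ => ?_
  rw [integral_const_mul, integral_add_right_eq_self (fun y => ‖g y‖ ^ 2)]

lemma cs_ball {d : ℕ} (s : ℝ) (hs : 0 < s) (v : EuclideanSpace ℝ (Fin d) → ℝ) (hv : Continuous v)
    (hsup : tsupport v ⊆ Metric.ball 0 (s / 2)) (hc : HasCompactSupport v) :
    (∫ x, ‖(v x : ℂ)‖) ^ 2 ≤ s ^ d * ∫ x, v x ^ 2 := by
  obtain ⟨B, hB⟩ : ∃ B, B = Metric.ball (0 : EuclideanSpace ℝ (Fin d)) (s / 2) := ⟨_, rfl⟩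
  rw [← hB] at hsup
  have hz : ∀ x, x ∉ B → v x = 0 := fun x hx => image_eq_zero_of_notMem_tsupport fun h => hx (hsup h)
  have e1 : ∫ x, ‖(v x : ℂ)‖ = ∫ x in B, |v x| := by
    simp only [Complex.norm_real, Real.norm_eq_abs]
    symm
    apply setIntegral_eq_integral_of_forall_compl_eq_zero
    intro x hx
    simp [hz x hx]
  have e2 : ∫ x, v x ^ 2 = ∫ x in B, v x ^ 2 := by
    symm
    apply setIntegral_eq_integral_of_forall_compl_eq_zero
    intro x hx
    simp [hz x hx]
  have i1 : IntegrableOn (fun x => |v x|) B :=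
    (integrable_comp_aux v hv hc (fun t => |t|) continuous_abs abs_zero).integrableOn
  have i2 : IntegrableOn (fun x => v x ^ 2) B :=
    (integrable_comp_aux v hv hc (fun t => t ^ 2) (by fun_prop) (by norm_num)).integrableOn
  have i3 : ∀ c : ℝ, IntegrableOn (fun _ => c) B := fun c =>
    integrableOn_const (by rw [hB]; exact measure_ball_lt_top.ne)
  rw [e1, e2]
  have hW : 0 < s ^ d := pow_pos hs d
  obtain ⟨A, hA⟩ : ∃ A, A = ∫ x in B, |v x| := ⟨_, rfl⟩
  obtain ⟨U, hU⟩ : ∃ A, A = ∫ x in B, v x ^ 2 := ⟨_, rfl⟩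
  obtain ⟨t, ht⟩ : ∃ t, t = A / s ^ d := ⟨_, rfl⟩
  have h0 : 0 ≤ ∫ x in B, (v x ^ 2 - 2 * t * |v x| + t ^ 2) := by
    apply integral_nonneg
    intro x
    have : v x ^ 2 - 2 * t * |v x| + t ^ 2 = (|v x| - t) ^ 2 := by rw [← sq_abs (v x)]; ring
    simp only [Pi.zero_apply, this]; positivity
  have i4 : IntegrableOn (fun x => v x ^ 2 - 2 * t * |v x|) B := i2.sub (i1.const_mul _)
  rw [integral_add i4 (i3 _), integral_sub i2 (i1.const_mul _),
    integral_const_mul, setIntegral_const, smul_eq_mul, ← hA, ← hU] at h0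
  have hV : volume.real B ≤ s ^ d := by rw [hB]; exact vol_ball s hs
  have h5 : 0 ≤ U - 2 * t * A + s ^ d * t ^ 2 := by
    nlinarith [mul_le_mul_of_nonneg_right hV (sq_nonneg t)]
  have h6 : A = t * s ^ d := by rw [ht]; field_simp
  rw [← hA, ← hU]
  have h7 : A * t = s ^ d * t ^ 2 := by rw [h6]; ring
  have h8 : A ^ 2 = s ^ d * (A * t) := by rw [h6]; ring
  rw [h8]
  exact mul_le_mul_of_nonneg_left (by linarith) hW.le

lemma fourier_sum {n d : ℕ} (x : Fin n → EuclideanSpace ℝ (Fin d)) (a : Fin n → ℝ)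
    (v : EuclideanSpace ℝ (Fin d) → ℝ) (hv : Continuous v) (hc : HasCompactSupport v)
    (w : EuclideanSpace ℝ (Fin d)) :
    𝓕 (fun y => ((∑ j, a j • v (y + x j) : ℝ) : ℂ)) w =
      (∑ j, (a j : ℂ) * Complex.exp (Complex.I * ((⟪(2 * Real.pi) • w, x j⟫_ℝ : ℝ) : ℂ))) *
        𝓕 (fun y => (v y : ℂ)) w := by
  have hi : Integrable (fun y => (v y : ℂ)) :=
    (hv.integrable_of_hasCompactSupport hc).ofReal
  have h1 : ∀ j, 𝓕 (fun y => (v (y + x j) : ℂ)) w =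
      Complex.exp (Complex.I * ((⟪(2 * Real.pi) • w, x j⟫_ℝ : ℝ) : ℂ)) *
        𝓕 (fun y => (v y : ℂ)) w := by
    intro j
    have := congrFun (VectorFourier.fourierIntegral_comp_add_right Real.fourierChar volume
      (innerₗ (EuclideanSpace ℝ (Fin d))) (fun y => (v y : ℂ)) (x j)) w
    refine Eq.trans this ?_
    rw [Circle.smul_def, smul_eq_mul, Real.fourierChar_apply]
    congr 2
    rw [innerₗ_apply_apply, real_inner_smul_left, real_inner_comm]
    push_cast; ring
  rw [Finset.sum_mul]
  simp only [mul_assoc, ← h1]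
  simp only [Real.fourier_eq]
  simp only [← integral_const_mul]
  rw [← integral_finsetSum]
  · congr 1; ext y
    simp only [Circle.smul_def, smul_eq_mul, Complex.ofReal_sum, Complex.ofReal_mul, Finset.mul_sum]
    refine Finset.sum_congr rfl fun j _ => by ring
  · intro j _
    apply Integrable.const_mul
    have h2 : Integrable (fun y => (v (y + x j) : ℂ)) := hi.comp_add_right (x j)
    exact (Real.fourierIntegral_convergent_iff w).2 h2

lemma core_ineq {n d : ℕ} (x : Fin n → EuclideanSpace ℝ (Fin d)) (a : Fin n → ℝ) (s : ℝ)
    (hs : 0 < s) (hx : ∀ i j, i ≠ j → s ≤ dist (x i) (x j))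
    (v : EuclideanSpace ℝ (Fin d) → ℝ) (hv : ContDiff ℝ 1 v)
    (hsup : tsupport v ⊆ Metric.ball 0 (s / 2)) (R : ℝ) (hR : 0 < R) :
    (R ^ 2 * (∫ y, v y ^ 2) - ∫ y, ‖fderiv ℝ v y‖ ^ 2) * ∑ j, a j ^ 2 ≤
      R ^ 2 * (s ^ d * (∫ y, v y ^ 2)) *
      ∫ w in Metric.ball (0 : EuclideanSpace ℝ (Fin d)) (R / (2 * Real.pi)),
        ‖∑ j, (a j : ℂ) * Complex.exp (Complex.I * ((⟪(2 * Real.pi) • w, x j⟫_ℝ : ℝ) : ℂ))‖ ^ 2 := by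
  have hpi := Real.pi_pos
  have hc : HasCompactSupport v :=
    HasCompactSupport.of_support_subset_isCompact (isCompact_closedBall 0 (s / 2))
      ((subset_tsupport v).trans (hsup.trans Metric.ball_subset_closedBall))
  obtain ⟨F, hF⟩ : ∃ F : EuclideanSpace ℝ (Fin d) → ℝ, F = fun y => ∑ j, a j • v (y + x j) :=
    ⟨_, rfl⟩
  have hvd : Differentiable ℝ v := hv.differentiable (by norm_num)
  have hFd : ContDiff ℝ 1 F := by rw [hF]; fun_prop
  have hFc : HasCompactSupport F := by
    apply HasCompactSupport.intro
      (isCompact_iUnion fun j => isCompact_closedBall (-(x j)) (s / 2))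
    intro y hy
    rw [hF]
    apply Finset.sum_eq_zero
    intro j _
    have : v (y + x j) = 0 := by
      apply image_eq_zero_of_notMem_tsupport
      intro h
      apply hy
      have hball := hsup h
      rw [Metric.mem_ball, dist_zero_right] at hball
      refine Set.mem_iUnion.2 ⟨j, ?_⟩
      rw [Metric.mem_closedBall, dist_eq_norm, sub_neg_eq_add]
      exact hball.le
    simp [this]
  have hF1 : ∫ y, ‖(F y : ℂ)‖ ^ 2 = (∑ j, a j ^ 2) * ∫ y, v y ^ 2 := by
    have := integral_norm_sq_sum x a s hx v hv.continuous hc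
      (fun y hy => image_eq_zero_of_notMem_tsupport fun h => hy (hsup h))
    simp only [Real.norm_eq_abs, sq_abs] at this
    rw [← this, hF]
    simp only [Complex.norm_real, Real.norm_eq_abs, sq_abs]
  have hF2 : ∫ y, ‖fderiv ℝ F y‖ ^ 2 = (∑ j, a j ^ 2) * ∫ y, ‖fderiv ℝ v y‖ ^ 2 := by
    have := integral_norm_sq_sum x a s hx (fderiv ℝ v) (hv.continuous_fderiv (by norm_num))
      (hc.fderiv ℝ) (fun y hy => by
        by_contra hne
        exact hy (hsup (support_fderiv_subset ℝ hne)))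
    rw [← this]
    congr 1; ext y
    congr 2
    rw [hF, fderiv_fun_sum (fun j _ => by fun_prop)]
    refine Finset.sum_congr rfl fun j _ => ?_
    rw [fderiv_fun_const_smul (by fun_prop), fderiv_comp_add_right]
  have hP1 := plancherel_aux (fun y => (F y : ℂ)) (by have := hFd.continuous; fun_prop)
    (hFc.comp_left (g := ((↑) : ℝ → ℂ)) (by simp))
  have hP2 := plancherel_deriv F hFd hFc
  have hle : ∀ w, ‖𝓕 (fun y => (v y : ℂ)) w‖ ^ 2 ≤ s ^ d * ∫ y, v y ^ 2 := by
    intro w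
    refine le_trans ?_ (cs_ball s hs v hv.continuous hsup hc)
    gcongr
    exact VectorFourier.norm_fourierIntegral_le_integral_norm _ _ _ _ _
  obtain ⟨G, hG⟩ : ∃ G : EuclideanSpace ℝ (Fin d) → ℂ, G = fun w =>
    ∑ j, (a j : ℂ) * Complex.exp (Complex.I * ((⟪(2 * Real.pi) • w, x j⟫_ℝ : ℝ) : ℂ)) := ⟨_, rfl⟩
  have hGc : Continuous G := by rw [hG]; fun_prop
  have hFG : ∀ w, 𝓕 (fun y => (F y : ℂ)) w = G w * 𝓕 (fun y => (v y : ℂ)) w := by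
    intro w
    rw [hF, hG]
    exact fourier_sum x a v hv.continuous hc w
  have hGe : ∫ w in Metric.ball (0 : EuclideanSpace ℝ (Fin d)) (R / (2 * Real.pi)),
        ‖∑ j, (a j : ℂ) * Complex.exp (Complex.I * ((⟪(2 * Real.pi) • w, x j⟫_ℝ : ℝ) : ℂ))‖ ^ 2 =
        ∫ w in Metric.ball (0 : EuclideanSpace ℝ (Fin d)) (R / (2 * Real.pi)), ‖G w‖ ^ 2 := by
    rw [hG]
  rw [hGe]
  clear hGe hG hF
  set B := Metric.ball (0 : EuclideanSpace ℝ (Fin d)) (R / (2 * Real.pi)) with hB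
  set K := s ^ d * ∫ y, v y ^ 2
  have hGi : IntegrableOn (fun w => R ^ 2 * K * ‖G w‖ ^ 2) B := by
    have : ContinuousOn (fun w => R ^ 2 * K * ‖G w‖ ^ 2)
      (Metric.closedBall (0 : EuclideanSpace ℝ (Fin d)) (R / (2 * Real.pi))) := by fun_prop
    exact (this.integrableOn_compact (isCompact_closedBall _ _)).mono_set
      Metric.ball_subset_closedBall
  calc _ = R ^ 2 * (∫ w, ‖𝓕 (fun y => (F y : ℂ)) w‖ ^ 2) -
        ∫ w, (2 * Real.pi * ‖w‖) ^ 2 * ‖𝓕 (fun x => (F x : ℂ)) w‖ ^ 2 := by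
        rw [hP1.2, hP2.2, hF1, hF2]; ring
    _ = ∫ w, (R ^ 2 * ‖𝓕 (fun y => (F y : ℂ)) w‖ ^ 2 -
        (2 * Real.pi * ‖w‖) ^ 2 * ‖𝓕 (fun x => (F x : ℂ)) w‖ ^ 2) := by
        rw [integral_sub (hP1.1.const_mul _) hP2.1, integral_const_mul]
    _ ≤ ∫ w, B.indicator (fun w => R ^ 2 * K * ‖G w‖ ^ 2) w := by
        apply integral_mono ((hP1.1.const_mul _).sub hP2.1)
          (hGi.integrable_indicator measurableSet_ball)
        intro w
        show R ^ 2 * ‖𝓕 (fun y => (F y : ℂ)) w‖ ^ 2 -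
          (2 * Real.pi * ‖w‖) ^ 2 * ‖𝓕 (fun x => (F x : ℂ)) w‖ ^ 2 ≤ _
        by_cases hw : w ∈ B
        · simp only [Set.indicator_of_mem hw, hFG, norm_mul, mul_pow]
          have h1 := mul_le_mul_of_nonneg_left (hle w) (by positivity : 0 ≤ R ^ 2 * ‖G w‖ ^ 2)
          have h2 : 0 ≤ 2 ^ 2 * Real.pi ^ 2 * ‖w‖ ^ 2 *
            (‖G w‖ ^ 2 * ‖𝓕 (fun y => (v y : ℂ)) w‖ ^ 2) := by positivity
          linarith
        · simp only [Set.indicator_of_notMem hw]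
          rw [← sub_mul]
          apply mul_nonpos_of_nonpos_of_nonneg _ (by positivity)
          rw [hB, Metric.mem_ball, dist_zero_right, not_lt, div_le_iff₀ (by positivity)] at hw
          have : R ^ 2 ≤ (2 * Real.pi * ‖w‖) ^ 2 := by
            apply pow_le_pow_left₀ hR.le; linarith
          linarith
    _ = _ := by
        rw [integral_indicator measurableSet_ball, integral_const_mul]

theorem stmt_5 (d : ℕ) (n : ℕ) (x : Fin n → EuclideanSpace ℝ (Fin d))
    (hx : Function.Injective x)
    (qX : ℝ) (hqX : IsLeast {r | ∃ i j, i ≠ j ∧ r = dist (x i) (x j)} qX)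
    (R : ℝ) (hR : Real.sqrt 2 * Real.sqrt (dirichletLambdaMin d) / qX ≤ R)
    (α : Fin n → ℝ) :
    Real.pi ^ ((d : ℝ) / 2) / (2 * dirichletLambdaMin d ^ ((d : ℝ) / 2)) * R ^ d *
        ∑ j, α j ^ 2 ≤
      ∫ ω in Metric.ball (0 : EuclideanSpace ℝ (Fin d)) R,
        ‖∑ j, (α j : ℂ) * Complex.exp (Complex.I * ((⟪ω, x j⟫_ℝ : ℝ) : ℂ))‖ ^ 2 := by
  have hRHS : 0 ≤ ∫ ω in Metric.ball (0 : EuclideanSpace ℝ (Fin d)) R,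
        ‖∑ j, (α j : ℂ) * Complex.exp (Complex.I * ((⟪ω, x j⟫_ℝ : ℝ) : ℂ))‖ ^ 2 :=
    integral_nonneg fun ω => by positivity
  obtain ⟨⟨i₀, j₀, hij, hq⟩, hmin⟩ := hqX
  have hqpos : 0 < qX := by rw [hq]; exact dist_pos.2 (hx.ne hij)
  have hd : d ≠ 0 := by
    rintro rfl
    exact hij (hx (Subsingleton.elim _ _))
  have hlam0 : 0 ≤ dirichletLambdaMin d := by
    apply Real.iInf_nonneg
    intro u
    exact div_nonneg (integral_nonneg fun _ => by positivity) (integral_nonneg fun _ => by positivity)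
  rcases hlam0.eq_or_lt with h0 | hlam
  · rw [← h0, Real.zero_rpow (by positivity)]
    simpa using hRHS
  have hex : ∃ u : {u : EuclideanSpace ℝ (Fin d) → ℝ //
      ContDiff ℝ 2 u ∧ tsupport u ⊆ Metric.ball 0 (1 / 2) ∧ (∫ x, u x ^ 2) ≠ 0},
      (∫ x, ‖fderiv ℝ u.1 x‖ ^ 2) / (∫ x, u.1 x ^ 2) < 3 / 2 * dirichletLambdaMin d := by
    have hne : Nonempty {u : EuclideanSpace ℝ (Fin d) → ℝ //
      ContDiff ℝ 2 u ∧ tsupport u ⊆ Metric.ball 0 (1 / 2) ∧ (∫ x, u x ^ 2) ≠ 0} := by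
      by_contra hcon
      rw [not_nonempty_iff] at hcon
      rw [dirichletLambdaMin, Real.iInf_of_isEmpty] at hlam
      exact lt_irrefl _ hlam
    apply exists_lt_of_ciInf_lt
    change dirichletLambdaMin d < _
    linarith
  obtain ⟨⟨u, hu2, husup, hu0⟩, hray⟩ := hex
  simp only at hray
  obtain ⟨lam, hlamdef⟩ : ∃ l, l = dirichletLambdaMin d := ⟨_, rfl⟩
  rw [← hlamdef] at hR hlam0 hlam hray ⊢
  have hUpos : 0 < ∫ x, u x ^ 2 :=
    lt_of_le_of_ne (integral_nonneg fun _ => by positivity) (Ne.symm hu0)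
  rw [div_lt_iff₀ hUpos] at hray
  have hpi := Real.pi_pos
  have ht : 0 < √2 := by positivity
  have hL : 0 < √lam := Real.sqrt_pos.2 hlam
  have hRpos : 0 < R := lt_of_lt_of_le (by positivity) hR
  obtain ⟨s, hs⟩ : ∃ s, s = √2 * √lam / R := ⟨_, rfl⟩
  have hspos : 0 < s := by rw [hs]; positivity
  have hsq : s ≤ qX := by
    rw [hs, div_le_iff₀ hRpos]
    rw [div_le_iff₀ hqpos] at hR
    linarith
  have hcore := core_ineq x α s hspos (fun i j h => hsq.trans (hmin ⟨i, j, h, rfl⟩))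
    (fun y => u (s⁻¹ • y)) ((hu2.of_le (by norm_num)).comp (by fun_prop)) (by
      refine (tsupport_comp_subset_preimage u (f := fun y => s⁻¹ • y) (by fun_prop)).trans ?_
      intro y hy
      have := husup hy
      rw [Metric.mem_ball, dist_zero_right, norm_smul, norm_inv, Real.norm_of_nonneg hspos.le,
        inv_mul_lt_iff₀ hspos] at this
      rw [Metric.mem_ball, dist_zero_right]
      linarith) R hRpos
  have hsc : ∀ f : EuclideanSpace ℝ (Fin d) → ℝ, ∫ y, f (s⁻¹ • y) = s ^ d * ∫ y, f y := by
    intro f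
    rw [Measure.integral_comp_inv_smul_of_nonneg _ _ hspos.le]
    simp
  have e1 : ∫ y, (u (s⁻¹ • y)) ^ 2 = s ^ d * ∫ y, u y ^ 2 := hsc fun y => u y ^ 2
  have e2 : ∫ y, ‖fderiv ℝ (fun y => u (s⁻¹ • y)) y‖ ^ 2 =
      (s⁻¹) ^ 2 * (s ^ d * ∫ y, ‖fderiv ℝ u y‖ ^ 2) := by
    rw [← hsc fun y => ‖fderiv ℝ u y‖ ^ 2, ← integral_const_mul]
    congr 1; ext y
    rw [fderiv_comp_smul, norm_smul, mul_pow, Real.norm_of_nonneg (by positivity)]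
  have e3 : ∫ w in Metric.ball (0 : EuclideanSpace ℝ (Fin d)) (R / (2 * Real.pi)),
        ‖∑ j, (α j : ℂ) * Complex.exp (Complex.I * ((⟪(2 * Real.pi) • w, x j⟫_ℝ : ℝ) : ℂ))‖ ^ 2
      = ((2 * Real.pi) ^ d)⁻¹ * ∫ ω in Metric.ball (0 : EuclideanSpace ℝ (Fin d)) R,
        ‖∑ j, (α j : ℂ) * Complex.exp (Complex.I * ((⟪ω, x j⟫_ℝ : ℝ) : ℂ))‖ ^ 2 := by
    rw [Measure.setIntegral_comp_smul_of_pos volume (fun ω : EuclideanSpace ℝ (Fin d) =>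
      ‖∑ j, (α j : ℂ) * Complex.exp (Complex.I * ((⟪ω, x j⟫_ℝ : ℝ) : ℂ))‖ ^ 2) _
      (by positivity : 0 < 2 * Real.pi), smul_ball (by positivity), smul_zero,
      Real.norm_of_nonneg (by positivity), mul_div_cancel₀ _ (by positivity)]
    simp
  rw [e1, e2, e3] at hcore
  rw [Real.rpow_div_two_eq_sqrt _ hpi.le, Real.rpow_div_two_eq_sqrt _ hlam.le,
    Real.rpow_natCast, Real.rpow_natCast]
  generalize (∫ ω in Metric.ball (0 : EuclideanSpace ℝ (Fin d)) R,
        ‖∑ j, (α j : ℂ) * Complex.exp (Complex.I * ((⟪ω, x j⟫_ℝ : ℝ) : ℂ))‖ ^ 2) = J at *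
  generalize (∫ y, u y ^ 2) = U at *
  generalize (∫ y, ‖fderiv ℝ u y‖ ^ 2) = D at *
  have hS : 0 ≤ ∑ j, α j ^ 2 := Finset.sum_nonneg fun j _ => by positivity
  generalize (∑ j, α j ^ 2) = S at *
  have hsinv : (s⁻¹) ^ 2 = R ^ 2 / (2 * lam) := by
    rw [hs, inv_div, div_pow, mul_pow, Real.sq_sqrt (by norm_num), Real.sq_sqrt hlam.le]
  have hP : 0 < s ^ d := by positivity
  have h1 : R ^ 2 * s ^ d * U * (1 / 4) * S ≤
      R ^ 2 * (s ^ d * (s ^ d * U)) * (((2 * Real.pi) ^ d)⁻¹ * J) := by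
    refine le_trans ?_ hcore
    apply mul_le_mul_of_nonneg_right _ hS
    have : s⁻¹ ^ 2 * (s ^ d * D) ≤ s⁻¹ ^ 2 * (s ^ d * (3 / 2 * lam * U)) := by gcongr
    have h2 : s⁻¹ ^ 2 * (s ^ d * (3 / 2 * lam * U)) = R ^ 2 * s ^ d * U * (3 / 4) := by
      rw [hsinv]; field_simp; norm_num
    linarith
  have h2 : 1 / 4 * S ≤ s ^ d * (((2 * Real.pi) ^ d)⁻¹ * J) := by
    have h3 : 0 < R ^ 2 * s ^ d * U := by positivity
    apply le_of_mul_le_mul_left _ h3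
    linarith
  have hp : 0 < √Real.pi := Real.sqrt_pos.2 hpi
  have h4 : (2 : ℝ) ≤ (√2 * √Real.pi) ^ d := by
    have h5 : (2 : ℝ) ≤ √2 * √Real.pi := by
      rw [← Real.sqrt_mul (by norm_num)]
      apply Real.le_sqrt_of_sq_le
      linarith [Real.pi_gt_three]
    calc (2 : ℝ) ≤ √2 * √Real.pi := h5
      _ ≤ _ := le_self_pow₀ (by linarith) hd
  have h6 : (2 * Real.pi) ^ d = (√2) ^ d * √Real.pi ^ d * (√2 * √Real.pi) ^ d := by
    rw [← mul_pow, ← mul_pow]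
    congr 1
    calc 2 * Real.pi = (√2) ^ 2 * (√Real.pi) ^ 2 := by
          rw [Real.sq_sqrt (by norm_num), Real.sq_sqrt hpi.le]
      _ = _ := by ring
  rw [h6, hs, div_pow, mul_pow] at h2
  generalize (√2 * √Real.pi) ^ d = Q at *
  have hRd : 0 < R ^ d := by positivity
  have hLd : 0 < √lam ^ d := by positivity
  have hpd : 0 < √Real.pi ^ d := by positivity
  have htd : 0 < √2 ^ d := by positivity
  generalize R ^ d = r at *
  generalize √lam ^ d = l at *
  generalize √Real.pi ^ d = p at *
  generalize √2 ^ d = t at *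
  have hQ : 0 < Q := by linarith
  have h7 : t * l / r * ((t * p * Q)⁻¹ * J) = l * J / (r * p * Q) := by field_simp
  rw [h7, le_div_iff₀ (by positivity)] at h2
  have h8 : p / (2 * l) * r * S = p * r * S / (2 * l) := by field_simp
  rw [h8, div_le_iff₀ (by positivity)]
  have h9 : 0 ≤ p * r * S := by positivity
  nlinarith [mul_le_mul_of_nonneg_left h4 h9]
end

section
/- Let k(x,z) = Φ(x−z) be a translational invariant kernel on ℝᵈ with Φ ∈ L¹(ℝᵈ), Φ̂ ≥ 0, and Fourier inversion valid. Then there exist constants c₀, c₁ > 0 depending only on d such that for any finite set X ⊂ ℝᵈ of pairwise distinct points with separation distance q_X, the smallest eigenvalue of the kernel matrix A = k(X,X) satisfies λ_min(A) ≥ (c₀ᵈ c₁ / (2π)^{d/2}) · min_{ω ∈ B_{c₀/q_X}(0)} Φ̂(ω) · q_X^{−d}. -/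
open MeasureTheory
open scoped InnerProductSpace

open scoped FourierTransform SchwartzMap LineDeriv

/-- The exponential sum (in the normalisation of Mathlib's Fourier transform). -/
noncomputable def expSum {d n : ℕ} (y : Fin n → EuclideanSpace ℝ (Fin d)) (v : Fin n → ℝ)
    (ω : EuclideanSpace ℝ (Fin d)) : ℂ :=
  ∑ j, (v j : ℂ) * Complex.exp (-(2 * Real.pi * Complex.I * ((⟪y j, ω⟫_ℝ : ℝ) : ℂ)))

lemma continuous_expSum {d n : ℕ} (y : Fin n → EuclideanSpace ℝ (Fin d)) (v : Fin n → ℝ) :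
    Continuous (expSum y v) := by
  unfold expSum
  fun_prop

lemma fourier_translate {d : ℕ} (G : 𝓢(EuclideanSpace ℝ (Fin d), ℂ))
    (a ω : EuclideanSpace ℝ (Fin d)) :
    𝓕 (G.compSubConstCLM ℂ a) ω =
      Complex.exp (-(2 * Real.pi * Complex.I * ((⟪a, ω⟫_ℝ : ℝ) : ℂ))) * 𝓕 G ω := by
  rw [SchwartzMap.fourier_coe, SchwartzMap.fourier_coe, Real.fourier_eq', Real.fourier_eq',
    ← integral_const_mul]
  rw [← integral_add_right_eq_self _ a]
  congr 1
  ext x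
  simp only [SchwartzMap.compSubConstCLM_apply, add_sub_cancel_right, smul_eq_mul, ← mul_assoc,
    ← Complex.exp_add, inner_add_left]
  congr 2
  push_cast
  ring

/-- superposition of translates -/
noncomputable def superpos {d n : ℕ} (G : 𝓢(EuclideanSpace ℝ (Fin d), ℂ))
    (y : Fin n → EuclideanSpace ℝ (Fin d)) (v : Fin n → ℝ) : 𝓢(EuclideanSpace ℝ (Fin d), ℂ) :=
  ∑ j, (v j : ℂ) • G.compSubConstCLM ℂ (y j)

lemma superpos_apply {d n : ℕ} (G : 𝓢(EuclideanSpace ℝ (Fin d), ℂ))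
    (y : Fin n → EuclideanSpace ℝ (Fin d)) (v : Fin n → ℝ) (x : EuclideanSpace ℝ (Fin d)) :
    superpos G y v x = ∑ j, (v j : ℂ) * G (x - y j) := by
  simp [superpos]

lemma fourier_superpos {d n : ℕ} (G : 𝓢(EuclideanSpace ℝ (Fin d), ℂ))
    (y : Fin n → EuclideanSpace ℝ (Fin d)) (v : Fin n → ℝ) (ω : EuclideanSpace ℝ (Fin d)) :
    𝓕 (superpos G y v) ω = expSum y v ω * 𝓕 G ω := by
  have h : 𝓕 (superpos G y v) = ∑ j, (v j : ℂ) • 𝓕 (G.compSubConstCLM ℂ (y j)) := by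
    unfold superpos
    rw [← SchwartzMap.fourierTransformCLM_apply (𝕜 := ℂ), map_sum]
    simp [SchwartzMap.fourierTransformCLM_apply]
  rw [h, sum_apply, expSum, Finset.sum_mul]
  refine Finset.sum_congr rfl fun j _ => ?_
  rw [smul_apply, fourier_translate, smul_eq_mul, ← mul_assoc]

lemma schwartz_sq_integrable {d : ℕ} (G : 𝓢(EuclideanSpace ℝ (Fin d), ℂ)) :
    Integrable (fun x => ‖G x‖ ^ 2) :=
  (memLp_two_iff_integrable_sq_norm G.continuous.aestronglyMeasurable).1 (G.memLp 2)

lemma superpos_norm_sq {d n : ℕ} (G : 𝓢(EuclideanSpace ℝ (Fin d), ℂ))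
    (hG : tsupport G ⊆ Metric.closedBall 0 (1 / 3))
    (y : Fin n → EuclideanSpace ℝ (Fin d)) (hy : ∀ i j, i ≠ j → 1 ≤ dist (y i) (y j))
    (v : Fin n → ℝ) (x : EuclideanSpace ℝ (Fin d)) :
    ‖superpos G y v x‖ ^ 2 = ∑ j, v j ^ 2 * ‖G (x - y j)‖ ^ 2 := by
  have hz : ∀ z, 1 / 3 < ‖z‖ → G z = 0 := fun z hz => by
    by_contra hne
    have := hG (subset_tsupport _ (Function.mem_support.2 hne))
    rw [mem_closedBall_zero_iff] at this
    linarith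
  rw [superpos_apply]
  by_cases h : ∃ i, ‖x - y i‖ ≤ 1 / 3
  · obtain ⟨i, hi⟩ := h
    have hj : ∀ j, j ≠ i → G (x - y j) = 0 := fun j hji => by
      apply hz
      have h1 := hy j i hji
      have h2 := dist_triangle (y j) x (y i)
      rw [dist_comm, dist_eq_norm] at h2
      have h3 := dist_eq_norm x (y i)
      have h4 := dist_eq_norm x (y j)
      have h5 := dist_comm x (y j)
      have h6 := dist_eq_norm (y i) (y j)
      have h7 := dist_comm (y i) (y j)
      linarith
    rw [Finset.sum_eq_single i, Finset.sum_eq_single i]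
    · simp [mul_pow]
    · intro j _ hji; simp [hj j hji]
    · simp
    · intro j _ hji; simp [hj j hji]
    · simp
  · push Not at h
    simp [hz _ (h _)]

lemma key_plancherel {d n : ℕ} (G : 𝓢(EuclideanSpace ℝ (Fin d), ℂ))
    (hG : tsupport G ⊆ Metric.closedBall 0 (1 / 3))
    (y : Fin n → EuclideanSpace ℝ (Fin d)) (hy : ∀ i j, i ≠ j → 1 ≤ dist (y i) (y j))
    (v : Fin n → ℝ) :
    ∫ ω, ‖expSum y v ω‖ ^ 2 * ‖𝓕 G ω‖ ^ 2 = (∑ j, v j ^ 2) * ∫ x, ‖G x‖ ^ 2 := by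
  have h := SchwartzMap.integral_norm_sq_fourier (superpos G y v)
  simp only [fourier_superpos, norm_mul, mul_pow] at h
  rw [h]
  simp only [superpos_norm_sq G hG y hy v]
  rw [integral_finsetSum, Finset.sum_mul]
  · refine Finset.sum_congr rfl fun j _ => ?_
    rw [integral_const_mul, integral_sub_right_eq_self (fun x => ‖G x‖ ^ 2)]
  · intro j _
    exact ((schwartz_sq_integrable G).comp_sub_right (y j)).const_mul _

lemma key_integrable {d n : ℕ} (G : 𝓢(EuclideanSpace ℝ (Fin d), ℂ))
    (y : Fin n → EuclideanSpace ℝ (Fin d)) (v : Fin n → ℝ) :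
    Integrable (fun ω => ‖expSum y v ω‖ ^ 2 * ‖𝓕 G ω‖ ^ 2) := by
  have h := schwartz_sq_integrable (𝓕 (superpos G y v))
  simpa only [fourier_superpos, norm_mul, mul_pow] using h

lemma exists_bump (d : ℕ) : ∃ U : 𝓢(EuclideanSpace ℝ (Fin d), ℂ),
    tsupport U ⊆ Metric.closedBall 0 (1 / 3) ∧ 0 < ∫ x, ‖U x‖ ^ 2 := by
  let b : ContDiffBump (0 : EuclideanSpace ℝ (Fin d)) := ⟨1 / 4, 1 / 3, by norm_num, by norm_num⟩
  have hcs : HasCompactSupport (fun x => ((b x : ℝ) : ℂ)) :=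
    b.hasCompactSupport.comp_left (g := fun r : ℝ => (r : ℂ)) (by simp)
  have hsm : ContDiff ℝ (⊤ : ℕ∞) (fun x => ((b x : ℝ) : ℂ)) :=
    Complex.ofRealCLM.contDiff.comp b.contDiff
  let U : 𝓢(EuclideanSpace ℝ (Fin d), ℂ) := hcs.toSchwartzMap hsm
  have hU : ∀ x, U x = ((b x : ℝ) : ℂ) := fun x => rfl
  have hUs : tsupport U ⊆ Metric.closedBall 0 (1 / 3) := by
    refine closure_minimal ?_ Metric.isClosed_closedBall
    intro x hx
    have : b x ≠ 0 := by
      intro h0; apply hx; rw [hU, h0]; simp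
    have h1 : x ∈ Function.support b := this
    rw [b.support_eq] at h1
    exact Metric.ball_subset_closedBall h1
  have ha : 0 < ∫ x, ‖U x‖ ^ 2 := by
    have hc : Continuous fun x => ‖U x‖ ^ 2 := by fun_prop
    refine hc.integral_pos_of_hasCompactSupport_nonneg_nonzero ?_ (fun x => by positivity) (x := 0) ?_
    · exact hcs.comp_left (g := fun z : ℂ => ‖z‖ ^ 2) (by simp)
    · have : b 0 = 1 := b.one_of_mem_closedBall (Metric.mem_closedBall_self b.rIn_pos.le)
      simp [hU, this]
  exact ⟨U, hUs, ha⟩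

set_option maxHeartbeats 1000000 in
/-- The analytic core: a lower bound for exponential sums with `1`-separated frequencies. -/
lemma core (d : ℕ) : ∃ ρ C : ℝ, 0 < ρ ∧ 0 < C ∧
    ∀ (n : ℕ) (y : Fin n → EuclideanSpace ℝ (Fin d)), (∀ i j, i ≠ j → 1 ≤ dist (y i) (y j)) →
    ∀ v : Fin n → ℝ,
      C * ∑ j, v j ^ 2 ≤ ∫ ω in Metric.closedBall 0 ρ, ‖expSum y v ω‖ ^ 2 := by
  obtain ⟨U, hUs, ha⟩ := exists_bump d
  set a := ∫ x, ‖U x‖ ^ 2 with ha_def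
  let e : Fin d → EuclideanSpace ℝ (Fin d) := fun m => EuclideanSpace.single m 1
  let D : Fin d → 𝓢(EuclideanSpace ℝ (Fin d), ℂ) := fun m => ∂_{e m} U
  have hD : ∀ m ω, ‖𝓕 (D m) ω‖ ^ 2 = (2 * Real.pi) ^ 2 * ω m ^ 2 * ‖𝓕 U ω‖ ^ 2 := by
    intro m ω
    have htg : (inner ℝ · (e m)).HasTemperateGrowth := ((innerSL ℝ).flip (e m)).hasTemperateGrowth
    simp only [D]
    rw [SchwartzMap.fourier_lineDerivOp_eq, smul_apply,
      SchwartzMap.smulLeftCLM_apply_apply htg]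
    simp [e, mul_pow, abs_of_pos Real.pi_pos, EuclideanSpace.inner_single_right, mul_assoc]
  set B := ∑ m, ∫ x, ‖D m x‖ ^ 2 with hB
  have hB0 : 0 ≤ B := Finset.sum_nonneg fun m _ => integral_nonneg fun x => by positivity
  obtain ⟨M, hM0, hM⟩ : ∃ M : ℝ, 0 < M ∧ ∀ ω, ‖𝓕 U ω‖ ^ 2 ≤ M := by
    refine ⟨‖U.toLp 1‖ ^ 2 + 1, by positivity, fun ω => ?_⟩
    have := SchwartzMap.norm_fourier_apply_le_toLp_one U ω
    have := pow_le_pow_left₀ (norm_nonneg _) this 2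
    linarith
  -- choose the radius
  obtain ⟨K, hKd⟩ : ∃ K : ℝ, K = (2 * Real.pi) ^ 2 := ⟨_, rfl⟩
  have hK : 0 < K := by rw [hKd]; positivity
  obtain ⟨t, htd⟩ : ∃ t : ℝ, t = 2 * B / (K * a) + 1 := ⟨_, rfl⟩
  have ht : 0 < t := by rw [htd]; positivity
  refine ⟨Real.sqrt t, a / (2 * M), Real.sqrt_pos.2 ht, by positivity, ?_⟩
  intro n y hy v
  have h1 := key_plancherel U hUs y hy v
  have hDs : ∀ m, tsupport (D m) ⊆ Metric.closedBall 0 (1 / 3) := fun m =>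
    (SchwartzMap.tsupport_lineDerivOp_subset (e m) U).trans hUs
  have h2 : ∀ m, ∫ ω, ‖expSum y v ω‖ ^ 2 * ‖𝓕 (D m) ω‖ ^ 2 = (∑ j, v j ^ 2) * ∫ x, ‖D m x‖ ^ 2 :=
    fun m => key_plancherel (D m) (hDs m) y hy v
  have hpt : ∀ ω, ∑ m, ‖expSum y v ω‖ ^ 2 * ‖𝓕 (D m) ω‖ ^ 2
      = K * ‖ω‖ ^ 2 * (‖expSum y v ω‖ ^ 2 * ‖𝓕 U ω‖ ^ 2) := by
    intro ω
    rw [EuclideanSpace.norm_sq_eq, Finset.mul_sum, Finset.sum_mul]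
    refine Finset.sum_congr rfl fun m _ => ?_
    rw [hD, Real.norm_eq_abs, sq_abs, hKd]
    ring
  have hi1 := key_integrable U y v
  have hi2 : Integrable fun ω => K * ‖ω‖ ^ 2 * (‖expSum y v ω‖ ^ 2 * ‖𝓕 U ω‖ ^ 2) := by
    have := integrable_finsetSum (μ := volume) Finset.univ
      (fun m (_ : m ∈ Finset.univ) => key_integrable (D m) y v)
    simpa only [hpt] using this
  have h3 : ∫ ω, K * ‖ω‖ ^ 2 * (‖expSum y v ω‖ ^ 2 * ‖𝓕 U ω‖ ^ 2) = (∑ j, v j ^ 2) * B := by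
    simp only [← hpt]
    rw [integral_finsetSum _ (fun m _ => key_integrable (D m) y v), hB, Finset.mul_sum]
    exact Finset.sum_congr rfl fun m _ => h2 m
  have hsq : ∀ ω, ω ∈ Metric.closedBall (0 : EuclideanSpace ℝ (Fin d)) (Real.sqrt t) ↔ ‖ω‖ ^ 2 ≤ t := by
    intro ω
    rw [mem_closedBall_zero_iff, Real.le_sqrt (norm_nonneg _) ht.le]
  have hci : IntegrableOn (fun ω => ‖expSum y v ω‖ ^ 2) (Metric.closedBall 0 (Real.sqrt t)) :=
    (((continuous_expSum y v).norm.pow 2).continuousOn).integrableOn_compact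
      (isCompact_closedBall _ _)
  have hcomp : ∫ ω, ((‖expSum y v ω‖ ^ 2 * ‖𝓕 U ω‖ ^ 2)
        - (K * t)⁻¹ * (K * ‖ω‖ ^ 2 * (‖expSum y v ω‖ ^ 2 * ‖𝓕 U ω‖ ^ 2)))
      ≤ ∫ ω, (Metric.closedBall 0 (Real.sqrt t)).indicator (fun ω => M * ‖expSum y v ω‖ ^ 2) ω := by
    refine integral_mono (hi1.sub (hi2.const_mul _)) ?_ ?_
    · exact (integrable_indicator_iff measurableSet_closedBall).2 (hci.const_mul M)
    · intro ω
      dsimp only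
      have hs : 0 ≤ ‖expSum y v ω‖ ^ 2 := by positivity
      have hu : 0 ≤ ‖𝓕 U ω‖ ^ 2 := by positivity
      have hrw : (K * t)⁻¹ * (K * ‖ω‖ ^ 2 * (‖expSum y v ω‖ ^ 2 * ‖𝓕 U ω‖ ^ 2))
          = (‖ω‖ ^ 2 / t) * (‖expSum y v ω‖ ^ 2 * ‖𝓕 U ω‖ ^ 2) := by
        field_simp
      rw [hrw]
      by_cases hω : ω ∈ Metric.closedBall (0 : EuclideanSpace ℝ (Fin d)) (Real.sqrt t)
      · rw [Set.indicator_of_mem hω]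
        have h5 : 0 ≤ ‖ω‖ ^ 2 / t * (‖expSum y v ω‖ ^ 2 * ‖𝓕 U ω‖ ^ 2) := by positivity
        have h6 := mul_le_mul_of_nonneg_left (hM ω) hs
        linarith
      · rw [Set.indicator_of_notMem hω]
        rw [hsq, not_le] at hω
        have h5 : 1 ≤ ‖ω‖ ^ 2 / t := (one_le_div ht).2 hω.le
        have h7 := mul_le_mul_of_nonneg_right h5 (mul_nonneg hs hu)
        rw [one_mul] at h7
        exact sub_nonpos.2 h7
  rw [integral_sub hi1 (hi2.const_mul _), integral_const_mul, h1, h3,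
    integral_indicator measurableSet_closedBall, integral_const_mul] at hcomp
  have hv : 0 ≤ ∑ j, v j ^ 2 := Finset.sum_nonneg fun j _ => sq_nonneg _
  have hBt : (K * t)⁻¹ * B ≤ a / 2 := by
    rw [inv_mul_le_iff₀ (by positivity)]
    have : K * t * (a / 2) = B + K * a / 2 := by
      rw [htd]; field_simp
    rw [this]
    have : 0 < K * a := by positivity
    linarith
  have hfin : a / 2 * ∑ j, v j ^ 2 ≤ M * ∫ ω in Metric.closedBall 0 (Real.sqrt t), ‖expSum y v ω‖ ^ 2 := by
    have h8 := mul_le_mul_of_nonneg_left hBt hv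
    refine le_trans ?_ hcomp
    have h9 : (K * t)⁻¹ * ((∑ j, v j ^ 2) * B) = (∑ j, v j ^ 2) * ((K * t)⁻¹ * B) := by ring
    rw [h9]
    linarith
  have : a / (2 * M) * ∑ j, v j ^ 2 = (a / 2 * ∑ j, v j ^ 2) / M := by field_simp
  rw [this, div_le_iff₀ hM0]
  linarith

lemma expSum_smul {d n : ℕ} (x : Fin n → EuclideanSpace ℝ (Fin d)) (v : Fin n → ℝ)
    (r : ℝ) (ω : EuclideanSpace ℝ (Fin d)) :
    expSum (fun j => r • x j) v ω = expSum x v (r • ω) := by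
  simp [expSum, inner_smul_left, inner_smul_right]

lemma norm_expSum_le {d n : ℕ} (x : Fin n → EuclideanSpace ℝ (Fin d)) (v : Fin n → ℝ)
    (ω : EuclideanSpace ℝ (Fin d)) : ‖expSum x v ω‖ ≤ ∑ j, |v j| := by
  refine (norm_sum_le _ _).trans (Finset.sum_le_sum fun j _ => ?_)
  rw [norm_mul, Complex.norm_exp]
  simp

lemma norm_sq_expSum {d n : ℕ} (x : Fin n → EuclideanSpace ℝ (Fin d)) (v : Fin n → ℝ)
    (ω : EuclideanSpace ℝ (Fin d)) :
    ((‖expSum x v ((2 * Real.pi)⁻¹ • ω)‖ ^ 2 : ℝ) : ℂ) =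
      ∑ i, ∑ j, (v i * v j : ℂ) * Complex.exp (Complex.I * ((⟪ω, x i - x j⟫_ℝ : ℝ) : ℂ)) := by
  have h : expSum x v ((2 * Real.pi)⁻¹ • ω) =
      ∑ j, (v j : ℂ) * Complex.exp (-(Complex.I * ((⟪ω, x j⟫_ℝ : ℝ) : ℂ))) := by
    unfold expSum
    refine Finset.sum_congr rfl fun j _ => ?_
    have hpi : (Real.pi : ℂ) ≠ 0 := by exact_mod_cast Real.pi_ne_zero
    rw [inner_smul_right, real_inner_comm]
    congr 3
    push_cast
    field_simp
  push_cast
  rw [← Complex.conj_mul', h, map_sum, Finset.sum_mul_sum]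
  refine Finset.sum_congr rfl fun i _ => Finset.sum_congr rfl fun j _ => ?_
  rw [map_mul, Complex.conj_ofReal, ← Complex.exp_conj, map_neg, map_mul, Complex.conj_I,
    Complex.conj_ofReal, mul_mul_mul_comm, ← Complex.exp_add, inner_sub_right]
  congr 2
  push_cast
  ring

lemma quad_form {d n : ℕ} (κ : ℝ) (Φ Φhat : EuclideanSpace ℝ (Fin d) → ℝ) (hIhat : Integrable Φhat)
    (hinv : ∀ y, (Φ y : ℂ) = (κ : ℂ) * ∫ ω : EuclideanSpace ℝ (Fin d),
              (Φhat ω : ℂ) * Complex.exp (Complex.I * ((⟪ω, y⟫_ℝ : ℝ) : ℂ)))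
    (x : Fin n → EuclideanSpace ℝ (Fin d)) (v : Fin n → ℝ) :
    ∑ i, ∑ j, v i * v j * Φ (x i - x j) =
      κ * ∫ ω, Φhat ω * ‖expSum x v ((2 * Real.pi)⁻¹ • ω)‖ ^ 2 := by
  have hi : ∀ y : EuclideanSpace ℝ (Fin d), Integrable fun ω : EuclideanSpace ℝ (Fin d) =>
      (Φhat ω : ℂ) * Complex.exp (Complex.I * ((⟪ω, y⟫_ℝ : ℝ) : ℂ)) := by
    intro y
    refine hIhat.ofReal.mul_bdd (c := 1) ?_ ?_
    · exact Continuous.aestronglyMeasurable (by fun_prop)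
    · refine Filter.Eventually.of_forall fun ω => ?_
      rw [Complex.norm_exp]; simp
  apply Complex.ofReal_injective
  push_cast
  rw [← integral_complex_ofReal]
  have : ∀ ω : EuclideanSpace ℝ (Fin d),
      ((Φhat ω * ‖expSum x v ((2 * Real.pi)⁻¹ • ω)‖ ^ 2 : ℝ) : ℂ) =
      ∑ i, ∑ j, (v i * v j : ℂ) *
        ((Φhat ω : ℂ) * Complex.exp (Complex.I * ((⟪ω, x i - x j⟫_ℝ : ℝ) : ℂ))) := by
    intro ω
    rw [Complex.ofReal_mul, norm_sq_expSum, Finset.mul_sum]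
    refine Finset.sum_congr rfl fun i _ => ?_
    rw [Finset.mul_sum]
    refine Finset.sum_congr rfl fun j _ => ?_
    ring
  simp only [this]
  rw [integral_finsetSum _ fun i _ => integrable_finsetSum _ fun j _ => (hi _).const_mul _,
    Finset.mul_sum]
  refine Finset.sum_congr rfl fun i _ => ?_
  rw [integral_finsetSum _ fun j _ => (hi _).const_mul _, Finset.mul_sum]
  refine Finset.sum_congr rfl fun j _ => ?_
  rw [integral_const_mul, hinv]
  ring

lemma integrable_hat {d : ℕ} (κ κ' : ℝ) (Φ Φhat : EuclideanSpace ℝ (Fin d) → ℝ)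
    (hhat : ∀ ω, (Φhat ω : ℂ) = (κ' : ℂ) * ∫ y : EuclideanSpace ℝ (Fin d),
              (Φ y : ℂ) * Complex.exp (-(Complex.I * ((⟪y, ω⟫_ℝ : ℝ) : ℂ))))
    (hinv : ∀ y, (Φ y : ℂ) = (κ : ℂ) * ∫ ω : EuclideanSpace ℝ (Fin d),
              (Φhat ω : ℂ) * Complex.exp (Complex.I * ((⟪ω, y⟫_ℝ : ℝ) : ℂ))) :
    Integrable Φhat := by
  by_contra hn
  have h0 : ∀ y, (Φ y : ℂ) = 0 := by
    intro y
    rw [hinv, integral_undef, mul_zero]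
    intro hI
    apply hn
    have h2 : Integrable fun ω : EuclideanSpace ℝ (Fin d) =>
        ((Φhat ω : ℂ) * Complex.exp (Complex.I * ((⟪ω, y⟫_ℝ : ℝ) : ℂ))) *
          Complex.exp (-(Complex.I * ((⟪ω, y⟫_ℝ : ℝ) : ℂ))) := by
      refine hI.mul_bdd (c := 1) ?_ ?_
      · exact Continuous.aestronglyMeasurable (by fun_prop)
      · refine Filter.Eventually.of_forall fun ω => ?_
        rw [Complex.norm_exp]; simp
    simp only [mul_assoc, ← Complex.exp_add, add_neg_cancel, Complex.exp_zero, mul_one] at h2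
    simpa using h2.re
  apply hn
  have : Φhat = 0 := by
    ext ω
    have := hhat ω
    simp only [h0] at this
    simpa using this
  rw [this]
  exact integrable_zero _ _ _

/-- Lower bound on the smallest eigenvalue of the kernel matrix of a translational
invariant kernel `k(x,z) = Φ(x−z)`, `Φ ∈ L¹`, with nonnegative Fourier transform and
valid Fourier inversion. One can take `c₀ = √2 λ_min(−Δ)^{1/2}` and
`c₁ = π^{d/2}/(2 λ_min(−Δ)^{d/2})`. -/
theorem stmt_6 (d : ℕ) :
    ∃ c₀ c₁ : ℝ, 0 < c₀ ∧ 0 < c₁ ∧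
      ∀ (Φ : EuclideanSpace ℝ (Fin d) → ℝ), Integrable Φ →
      ∀ (Φhat : EuclideanSpace ℝ (Fin d) → ℝ),
        (∀ ω, (Φhat ω : ℂ) =
          ((2 * Real.pi) ^ (-(d : ℝ) / 2) : ℝ) *
            ∫ y : EuclideanSpace ℝ (Fin d),
              (Φ y : ℂ) * Complex.exp (-(Complex.I * ((⟪y, ω⟫_ℝ : ℝ) : ℂ)))) →
        (∀ ω, 0 ≤ Φhat ω) →
        (∀ y, (Φ y : ℂ) =
          ((2 * Real.pi) ^ (-(d : ℝ) / 2) : ℝ) *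
            ∫ ω : EuclideanSpace ℝ (Fin d),
              (Φhat ω : ℂ) * Complex.exp (Complex.I * ((⟪ω, y⟫_ℝ : ℝ) : ℂ))) →
      ∀ (n : ℕ) (x : Fin n → EuclideanSpace ℝ (Fin d)), Function.Injective x →
      ∀ qX : ℝ, IsLeast {r | ∃ i j, i ≠ j ∧ r = dist (x i) (x j)} qX →
      ∀ hA : (Matrix.of fun i j => Φ (x i - x j) : Matrix (Fin n) (Fin n) ℝ).IsHermitian,
      ∀ i : Fin n,
        c₀ ^ d * c₁ / (2 * Real.pi) ^ ((d : ℝ) / 2) *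
            sInf (Φhat '' Metric.closedBall 0 (c₀ / qX)) * qX ^ (-(d : ℝ)) ≤
          hA.eigenvalues i := by
  obtain ⟨ρ, C, hρ, hC, hcore⟩ := core d
  have hpi := Real.pi_pos
  refine ⟨2 * Real.pi * ρ, C / ρ ^ d, by positivity, by positivity, ?_⟩
  intro Φ hΦ Φhat hhat hpos hinv n x hx q hq hA i
  have hIhat := integrable_hat _ _ Φ Φhat hhat hinv
  have hq0 : 0 < q := by
    obtain ⟨a, b, hab, hr⟩ := hq.1
    rw [hr]
    exact dist_pos.2 fun h => hab (hx h)
  let v : Fin n → ℝ := fun j => hA.eigenvectorBasis i j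
  have hv : ∑ j, v j ^ 2 = 1 := by
    have h1 := hA.eigenvectorBasis.orthonormal.1 i
    have h2 := EuclideanSpace.norm_sq_eq (hA.eigenvectorBasis i)
    rw [h1] at h2
    simpa [v] using h2.symm
  have hlam : hA.eigenvalues i = ∑ a, ∑ b, v a * v b * Φ (x a - x b) := by
    rw [hA.eigenvalues_eq]
    simp only [dotProduct, Matrix.mulVec, Finset.mul_sum, RCLike.re_to_real, Pi.star_apply,
      star_trivial, Matrix.of_apply, v]
    refine Finset.sum_congr rfl fun a _ => Finset.sum_congr rfl fun b _ => ?_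
    ring
  rw [hlam, quad_form _ Φ Φhat hIhat hinv x v]
  set m := sInf (Φhat '' Metric.closedBall 0 (2 * Real.pi * ρ / q)) with hm
  have hbdd : BddBelow (Φhat '' Metric.closedBall 0 (2 * Real.pi * ρ / q)) :=
    ⟨0, by rintro _ ⟨ω, _, rfl⟩; exact hpos ω⟩
  have hm0 : 0 ≤ m := Real.sInf_nonneg (by rintro _ ⟨ω, _, rfl⟩; exact hpos ω)
  have hmle : ∀ ω ∈ Metric.closedBall 0 (2 * Real.pi * ρ / q), m ≤ Φhat ω := fun ω hω =>
    csInf_le hbdd ⟨ω, hω, rfl⟩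
  have hcont : Continuous fun ω : EuclideanSpace ℝ (Fin d) =>
      ‖expSum x v ((2 * Real.pi)⁻¹ • ω)‖ ^ 2 :=
    ((continuous_expSum x v).comp (continuous_const_smul _)).norm.pow 2
  have hI : Integrable fun ω => Φhat ω * ‖expSum x v ((2 * Real.pi)⁻¹ • ω)‖ ^ 2 := by
    refine hIhat.mul_bdd (c := (∑ j, |v j|) ^ 2) hcont.aestronglyMeasurable ?_
    refine Filter.Eventually.of_forall fun ω => ?_
    rw [norm_pow, norm_norm]
    exact pow_le_pow_left₀ (norm_nonneg _) (norm_expSum_le _ _ _) 2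
  have hI2 : IntegrableOn (fun ω : EuclideanSpace ℝ (Fin d) =>
      ‖expSum x v ((2 * Real.pi)⁻¹ • ω)‖ ^ 2) (Metric.closedBall 0 (2 * Real.pi * ρ / q)) :=
    hcont.continuousOn.integrableOn_compact (isCompact_closedBall _ _)
  have step1 : m * ∫ ω in Metric.closedBall 0 (2 * Real.pi * ρ / q),
        ‖expSum x v ((2 * Real.pi)⁻¹ • ω)‖ ^ 2 ≤
      ∫ ω, Φhat ω * ‖expSum x v ((2 * Real.pi)⁻¹ • ω)‖ ^ 2 := by
    rw [← integral_const_mul]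
    refine le_trans ?_ (setIntegral_le_integral (s := Metric.closedBall 0 (2 * Real.pi * ρ / q)) hI
      (Filter.Eventually.of_forall fun ω => mul_nonneg (hpos ω) (sq_nonneg _)))
    refine setIntegral_mono_on (hI2.const_mul m) hI.integrableOn measurableSet_closedBall ?_
    intro ω hω
    exact mul_le_mul_of_nonneg_right (hmle ω hω) (sq_nonneg _)
  have hsep : ∀ a b, a ≠ b → 1 ≤ dist (q⁻¹ • x a) (q⁻¹ • x b) := by
    intro a b hab
    rw [dist_smul₀, Real.norm_eq_abs, abs_of_pos (inv_pos.2 hq0), inv_mul_eq_div, one_le_div hq0]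
    exact hq.2 ⟨a, b, hab, rfl⟩
  have step2 := hcore n (fun j => q⁻¹ • x j) hsep v
  rw [hv, mul_one] at step2
  have hR : 0 < q / (2 * Real.pi) := by positivity
  have step3 := Measure.setIntegral_comp_smul_of_pos (volume : Measure (EuclideanSpace ℝ (Fin d)))
    (fun ω => ‖expSum (fun j => q⁻¹ • x j) v ω‖ ^ 2)
    (Metric.closedBall 0 (2 * Real.pi * ρ / q)) hR
  open scoped Pointwise in
  have hball : (q / (2 * Real.pi)) • Metric.closedBall (0 : EuclideanSpace ℝ (Fin d))
      (2 * Real.pi * ρ / q) = Metric.closedBall 0 ρ := by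
    rw [smul_closedBall' hR.ne', smul_zero, Real.norm_eq_abs, abs_of_pos hR]
    congr 1
    field_simp
  have hqq : q⁻¹ * (q / (2 * Real.pi)) = (2 * Real.pi)⁻¹ := by field_simp
  simp only [expSum_smul, smul_smul, hqq] at step3
  simp only [expSum_smul] at step2
  rw [hball, finrank_euclideanSpace_fin, smul_eq_mul] at step3
  have step4 : m * (((q / (2 * Real.pi)) ^ d)⁻¹ * C) ≤
      ∫ ω, Φhat ω * ‖expSum x v ((2 * Real.pi)⁻¹ • ω)‖ ^ 2 := by
    refine le_trans ?_ step1
    rw [step3]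
    gcongr
  refine le_trans (le_of_eq ?_) (mul_le_mul_of_nonneg_left step4 (by positivity))
  have hP : 0 < (2 * Real.pi) ^ ((d : ℝ) / 2) := by positivity
  rw [neg_div, Real.rpow_neg (show (0 : ℝ) ≤ 2 * Real.pi by positivity), Real.rpow_neg hq0.le,
    Real.rpow_natCast]
  generalize (2 * Real.pi) ^ ((d : ℝ) / 2) = P at hP ⊢
  rw [mul_pow (2 * Real.pi) ρ, div_pow]
  field_simp
end

section
/- Let τ > d/2 and Ω ⊂ ℝᵈ be bounded. For every ε ∈ (0,1) there exists a constant a = a_ε > 0 depending only on ε, d, τ, Ω such that for every finite set X ⊂ Ω of pairwise distinct points, every α ∈ ℝ^{|X|}, and every R ≥ max(a, π)/q_X: (1−ε) ∫_{ℝᵈ} (1+‖ω‖²)^{−τ} |Σ_j α_j e^{iωᵀx_j}|² dω ≤ ∫_{B_{2R}(0)} (1+‖ω‖²)^{−τ} |Σ_j α_j e^{iωᵀx_j}|² dω. -/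
open MeasureTheory
open scoped InnerProductSpace

noncomputable def FF {d n : ℕ} (x : Fin n → EuclideanSpace ℝ (Fin d)) (α : Fin n → ℝ)
    (ω : EuclideanSpace ℝ (Fin d)) : ℝ :=
  ‖∑ j, (α j : ℂ) * Complex.exp (Complex.I * ((⟪ω, x j⟫_ℝ : ℝ) : ℂ))‖ ^ 2

lemma FF_cont {d n : ℕ} (x : Fin n → EuclideanSpace ℝ (Fin d)) (α : Fin n → ℝ) :
    Continuous (FF x α) := by
  unfold FF
  fun_prop

lemma FF_nonneg {d n : ℕ} (x : Fin n → EuclideanSpace ℝ (Fin d)) (α : Fin n → ℝ) (ω) :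
    0 ≤ FF x α ω := by
  unfold FF
  positivity

lemma FF_le {d n : ℕ} (x : Fin n → EuclideanSpace ℝ (Fin d)) (α : Fin n → ℝ) (ω) :
    FF x α ω ≤ (∑ j, |α j|) ^ 2 := by
  unfold FF
  gcongr
  refine (norm_sum_le _ _).trans (Finset.sum_le_sum fun j _ => ?_)
  rw [norm_mul, mul_comm Complex.I, Complex.norm_exp_ofReal_mul_I]
  simp

lemma FF_expand {d n : ℕ} (x : Fin n → EuclideanSpace ℝ (Fin d)) (α : Fin n → ℝ) (ω) :
    ((FF x α ω : ℝ) : ℂ) = ∑ j, ∑ k, (α j : ℂ) * (α k : ℂ) *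
      Complex.exp (Complex.I * ((⟪x j - x k, ω⟫_ℝ : ℝ) : ℂ)) := by
  unfold FF
  rw [Complex.ofReal_pow, ← Complex.mul_conj', map_sum, Finset.sum_mul_sum]
  refine Finset.sum_congr rfl fun j _ => Finset.sum_congr rfl fun k _ => ?_
  rw [map_mul, ← Complex.exp_conj, map_mul, Complex.conj_I, Complex.conj_ofReal,
    Complex.conj_ofReal, mul_mul_mul_comm, ← Complex.exp_add]
  congr 2
  rw [inner_sub_left, real_inner_comm (x j), real_inner_comm (x k)]
  push_cast
  ring

lemma integrable_gauss {d : ℕ} {b : ℝ} (hb : 0 < b) :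
    Integrable (fun ω : EuclideanSpace ℝ (Fin d) => Real.exp (-b * ‖ω‖ ^ 2)) := by
  have h := GaussianFourier.integrable_cexp_neg_mul_sq_norm_add (b := (b : ℂ)) (by simpa using hb) 0
    (0 : EuclideanSpace ℝ (Fin d))
  have h2 := h.norm
  refine h2.congr (Filter.Eventually.of_forall fun ω => ?_)
  simp only [Complex.norm_exp]
  congr 1
  rw [zero_mul, add_zero]
  norm_cast

lemma integrable_mul_FF {d n : ℕ} (x : Fin n → EuclideanSpace ℝ (Fin d)) (α : Fin n → ℝ)
    {g : EuclideanSpace ℝ (Fin d) → ℝ} (hg : Integrable g) :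
    Integrable (fun ω => g ω * FF x α ω) := by
  refine hg.mul_bdd (c := (∑ j, |α j|) ^ 2) (FF_cont x α).aestronglyMeasurable
    (Filter.Eventually.of_forall fun ω => ?_)
  rw [Real.norm_of_nonneg (FF_nonneg ..)]
  exact FF_le ..

lemma gauss_form {d n : ℕ} (x : Fin n → EuclideanSpace ℝ (Fin d)) (α : Fin n → ℝ)
    {b : ℝ} (hb : 0 < b) :
    ∫ ω, Real.exp (-b * ‖ω‖ ^ 2) * FF x α ω =
      (Real.pi / b) ^ ((d : ℝ) / 2) *
        ∑ j, ∑ k, α j * α k * Real.exp (-‖x j - x k‖ ^ 2 / (4 * b)) := by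
  have hb' : 0 < (b : ℂ).re := by simpa using hb
  apply Complex.ofReal_injective
  rw [← integral_complex_ofReal]
  have h1 : ∀ ω : EuclideanSpace ℝ (Fin d),
      ((Real.exp (-b * ‖ω‖ ^ 2) * FF x α ω : ℝ) : ℂ) =
      ∑ j, ∑ k, ((α j : ℂ) * (α k : ℂ)) *
        Complex.exp (-(b : ℂ) * (‖ω‖ : ℂ) ^ 2 + Complex.I * ((⟪x j - x k, ω⟫_ℝ : ℝ) : ℂ)) := by
    intro ω
    rw [Complex.ofReal_mul, FF_expand, Finset.mul_sum]
    refine Finset.sum_congr rfl fun j _ => ?_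
    rw [Finset.mul_sum]
    refine Finset.sum_congr rfl fun k _ => ?_
    rw [Complex.exp_add]
    push_cast
    ring
  simp_rw [h1]
  have hi : ∀ j k, Integrable (fun ω : EuclideanSpace ℝ (Fin d) => ((α j : ℂ) * (α k : ℂ)) *
        Complex.exp (-(b : ℂ) * (‖ω‖ : ℂ) ^ 2 + Complex.I * ((⟪x j - x k, ω⟫_ℝ : ℝ) : ℂ))) :=
    fun j k => (GaussianFourier.integrable_cexp_neg_mul_sq_norm_add hb' _ _).const_mul _
  rw [integral_finsetSum _ fun j _ => integrable_finsetSum _ fun k _ => hi j k]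
  rw [Complex.ofReal_mul, Complex.ofReal_sum, Finset.mul_sum]
  refine Finset.sum_congr rfl fun j _ => ?_
  rw [integral_finsetSum _ fun k _ => hi j k, Complex.ofReal_sum, Finset.mul_sum]
  refine Finset.sum_congr rfl fun k _ => ?_
  rw [integral_const_mul, GaussianFourier.integral_cexp_neg_mul_sq_norm_add hb']
  rw [Complex.ofReal_mul, Complex.ofReal_mul, Complex.ofReal_cpow (by positivity)]
  simp only [finrank_euclideanSpace, Fintype.card_fin, Complex.I_sq]
  push_cast
  rw [neg_one_mul]
  ring

/-- packing bound -/
lemma packing (d : ℕ) : ∃ M : ℝ, 0 < M ∧ ∀ (n : ℕ) (y : Fin n → EuclideanSpace ℝ (Fin d)),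
    (∀ i j, i ≠ j → 1 ≤ dist (y i) (y j)) → ∑ k, Real.exp (-‖y k‖ ^ 2 / 4) ≤ M := by
  set V : ℝ := volume.real (Metric.ball (0 : EuclideanSpace ℝ (Fin d)) (1/2)) with hV
  have hVpos : 0 < V := by
    rw [hV, measureReal_def]
    exact ENNReal.toReal_pos (Metric.measure_ball_pos _ _ (by norm_num)).ne' measure_ball_lt_top.ne
  set J : ℝ := ∫ z : EuclideanSpace ℝ (Fin d), Real.exp (-(1/8) * ‖z‖ ^ 2) with hJ
  have hJi : Integrable (fun z : EuclideanSpace ℝ (Fin d) => Real.exp (-(1/8) * ‖z‖ ^ 2)) :=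
    integrable_gauss (by norm_num)
  have hJ0 : 0 ≤ J := integral_nonneg fun z => (Real.exp_pos _).le
  refine ⟨Real.exp (1/16) / V * J + 1, by positivity, fun n y hy => ?_⟩
  have key : ∀ k, Real.exp (-‖y k‖ ^ 2 / 4) ≤
      Real.exp (1/16) / V * ∫ z in Metric.ball (y k) (1/2), Real.exp (-(1/8) * ‖z‖ ^ 2) := by
    intro k
    have hVk : volume.real (Metric.ball (y k) (1/2)) = V := by
      rw [hV, measureReal_def, measureReal_def, Measure.addHaar_ball_center]
    have : ∫ z in Metric.ball (y k) (1/2), Real.exp (-(1/16)) * Real.exp (-‖y k‖ ^ 2 / 4) ≤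
        ∫ z in Metric.ball (y k) (1/2), Real.exp (-(1/8) * ‖z‖ ^ 2) := by
      refine setIntegral_mono_on (integrableOn_const (by exact measure_ball_lt_top.ne))
        hJi.integrableOn measurableSet_ball fun z hz => ?_
      rw [← Real.exp_add]
      apply Real.exp_le_exp.2
      have h1 : ‖z‖ ≤ ‖y k‖ + 1/2 := by
        have := norm_le_norm_add_norm_sub' z (y k)
        have h2 := Metric.mem_ball.1 hz
        rw [dist_eq_norm] at h2
        linarith
      have h0 := norm_nonneg z
      nlinarith [sq_nonneg (‖y k‖ - 1/2)]
    rw [setIntegral_const, hVk, smul_eq_mul, Real.exp_neg] at this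
    have hE := Real.exp_pos (1/16)
    calc Real.exp (-‖y k‖ ^ 2 / 4) = Real.exp (1/16) / V * (V * ((Real.exp (1/16))⁻¹ *
          Real.exp (-‖y k‖ ^ 2 / 4))) := by field_simp
      _ ≤ _ := by gcongr
  calc ∑ k, Real.exp (-‖y k‖ ^ 2 / 4) ≤ ∑ k, Real.exp (1/16) / V *
        ∫ z in Metric.ball (y k) (1/2), Real.exp (-(1/8) * ‖z‖ ^ 2) :=
        Finset.sum_le_sum fun k _ => key k
    _ = Real.exp (1/16) / V * ∫ z in ⋃ k, Metric.ball (y k) (1/2),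
          Real.exp (-(1/8) * ‖z‖ ^ 2) := by
        rw [integral_iUnion_fintype (fun _ => measurableSet_ball) ?_ (fun _ => hJi.integrableOn),
          Finset.mul_sum]
        intro i j hij
        refine Metric.ball_disjoint_ball ?_
        have := hy i j hij
        linarith
    _ ≤ Real.exp (1/16) / V * J := by
        gcongr
        exact setIntegral_le_integral hJi (Filter.Eventually.of_forall fun z => (Real.exp_pos _).le)
    _ ≤ _ := by linarith

lemma packing2 (d : ℕ) : ∃ b₀ : ℝ, 0 < b₀ ∧ ∀ (n : ℕ) (x : Fin n → EuclideanSpace ℝ (Fin d))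
    (q : ℝ), 0 < q → (∀ i j, i ≠ j → q ≤ dist (x i) (x j)) → ∀ b, 0 < b → b ≤ b₀ * q ^ 2 → ∀ j,
    ∑ k ∈ Finset.univ.erase j, Real.exp (-‖x j - x k‖ ^ 2 / (4 * b)) ≤ 1 / 2 := by
  obtain ⟨M, hM, h⟩ := packing d
  -- need exp(-(1/b₀ - 1)/4) M ≤ 1/2
  obtain ⟨s, hs1, hs⟩ : ∃ s : ℝ, 1 ≤ s ∧ Real.exp (-(s - 1) / 4) * M ≤ 1 / 2 := by
    refine ⟨1 + 4 * (2 * M), by linarith, ?_⟩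
    have h1 := Real.add_one_le_exp (2 * M)
    have : -(1 + 4 * (2 * M) - 1) / 4 = -(2 * M) := by ring
    rw [this, Real.exp_neg, inv_mul_le_iff₀ (Real.exp_pos _)]
    linarith
  have hs0 : 0 < s := by linarith
  refine ⟨1 / s, by positivity, fun n x q hq hx b hb hbq j => ?_⟩
  have h2 := h n (fun k => q⁻¹ • (x j - x k)) (fun i k hik => by
    rw [dist_smul₀, dist_sub_left, Real.norm_of_nonneg (by positivity), inv_mul_eq_div,
      le_div_iff₀ hq, one_mul]
    exact hx i k hik)
  calc ∑ k ∈ Finset.univ.erase j, Real.exp (-‖x j - x k‖ ^ 2 / (4 * b))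
      ≤ ∑ k ∈ Finset.univ.erase j, Real.exp (-(s - 1) / 4) *
          Real.exp (-‖q⁻¹ • (x j - x k)‖ ^ 2 / 4) := by
        refine Finset.sum_le_sum fun k hk => ?_
        rw [← Real.exp_add]
        apply Real.exp_le_exp.2
        have hjk := hx j k (Finset.ne_of_mem_erase hk).symm
        rw [dist_eq_norm] at hjk
        rw [norm_smul, Real.norm_of_nonneg (by positivity : 0 ≤ q⁻¹), inv_mul_eq_div]
        set u := ‖x j - x k‖ / q with hu
        have hu1 : 1 ≤ u := by rw [hu, le_div_iff₀ hq]; linarith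
        have hxu : ‖x j - x k‖ = u * q := by rw [hu]; field_simp
        rw [hxu]
        have h3 : s * u ^ 2 / 4 ≤ (u * q) ^ 2 / (4 * b) := by
          rw [div_le_div_iff₀ (by norm_num) (by positivity)]
          have : s * b ≤ q ^ 2 := by
            calc s * b ≤ s * (1 / s * q ^ 2) := by gcongr
              _ = q ^ 2 := by field_simp
          nlinarith [mul_le_mul_of_nonneg_left this (sq_nonneg u)]
        rw [neg_div]
        nlinarith [mul_nonneg (by linarith : 0 ≤ s - 1) (by nlinarith : 0 ≤ u ^ 2 - 1)]
    _ ≤ ∑ k, Real.exp (-(s - 1) / 4) * Real.exp (-‖q⁻¹ • (x j - x k)‖ ^ 2 / 4) :=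
        Finset.sum_le_sum_of_subset_of_nonneg (Finset.erase_subset _ _) fun _ _ _ => by positivity
    _ ≤ 1 / 2 := by
        rw [← Finset.mul_sum]
        exact (mul_le_mul_of_nonneg_left h2 (Real.exp_pos _).le).trans hs

lemma schur {n : ℕ} (A : Fin n → Fin n → ℝ) (h0 : ∀ j k, 0 ≤ A j k) (hd : ∀ j, A j j = 1)
    (hsymm : ∀ j k, A j k = A k j) (hA : ∀ j, ∑ k ∈ Finset.univ.erase j, A j k ≤ 1 / 2)
    (α : Fin n → ℝ) :
    |(∑ j, ∑ k, α j * α k * A j k) - ∑ j, α j ^ 2| ≤ 1 / 2 * ∑ j, α j ^ 2 := by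
  have e1 : (∑ j, ∑ k, α j * α k * A j k) - ∑ j, α j ^ 2 =
      ∑ j, ∑ k ∈ Finset.univ.erase j, α j * α k * A j k := by
    rw [← Finset.sum_sub_distrib]
    refine Finset.sum_congr rfl fun j _ => ?_
    rw [← Finset.add_sum_erase _ _ (Finset.mem_univ j), hd]
    ring
  have e2 : ∀ g : Fin n → Fin n → ℝ, ∑ j, ∑ k ∈ Finset.univ.erase j, g j k =
      ∑ j, ∑ k, if k = j then 0 else g j k := by
    intro g
    refine Finset.sum_congr rfl fun j _ => ?_
    rw [← Finset.add_sum_erase _ _ (Finset.mem_univ j)]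
    simp only [if_true, zero_add]
    exact Finset.sum_congr rfl fun k hk => by rw [if_neg (Finset.ne_of_mem_erase hk)]
  have e3 : ∑ j, ∑ k ∈ Finset.univ.erase j, α k ^ 2 * A j k =
      ∑ j, ∑ k ∈ Finset.univ.erase j, α j ^ 2 * A j k := by
    rw [e2, e2, Finset.sum_comm]
    refine Finset.sum_congr rfl fun j _ => Finset.sum_congr rfl fun k _ => ?_
    rw [hsymm k j]
    simp only [eq_comm]
  rw [e1]
  calc |∑ j, ∑ k ∈ Finset.univ.erase j, α j * α k * A j k|
      ≤ ∑ j, ∑ k ∈ Finset.univ.erase j, |α j * α k * A j k| :=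
        (Finset.abs_sum_le_sum_abs _ _).trans
          (Finset.sum_le_sum fun j _ => Finset.abs_sum_le_sum_abs _ _)
    _ ≤ ∑ j, ∑ k ∈ Finset.univ.erase j, (1/2 * (α j ^ 2 * A j k) + 1/2 * (α k ^ 2 * A j k)) := by
        refine Finset.sum_le_sum fun j _ => Finset.sum_le_sum fun k _ => ?_
        rw [abs_mul, abs_of_nonneg (h0 j k), abs_mul]
        have : |α j| * |α k| ≤ 1/2 * α j ^ 2 + 1/2 * α k ^ 2 := by
          nlinarith [sq_nonneg (|α j| - |α k|), sq_abs (α j), sq_abs (α k)]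
        nlinarith [mul_le_mul_of_nonneg_right this (h0 j k)]
    _ = ∑ j, ∑ k ∈ Finset.univ.erase j, α j ^ 2 * A j k := by
        simp_rw [Finset.sum_add_distrib, ← Finset.mul_sum] 
        simp_rw [← Finset.mul_sum] at e3
        rw [e3]; ring
    _ ≤ ∑ j, 1 / 2 * α j ^ 2 := by
        refine Finset.sum_le_sum fun j _ => ?_
        rw [← Finset.mul_sum]
        nlinarith [mul_le_mul_of_nonneg_left (hA j) (sq_nonneg (α j))]
    _ = _ := by rw [Finset.mul_sum]

lemma gauss_bounds (d : ℕ) : ∃ b₀ : ℝ, 0 < b₀ ∧ ∀ (n : ℕ) (x : Fin n → EuclideanSpace ℝ (Fin d))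
    (q : ℝ), 0 < q → (∀ i j, i ≠ j → q ≤ dist (x i) (x j)) → ∀ α : Fin n → ℝ,
    ∀ b, 0 < b → b ≤ b₀ * q ^ 2 →
    (Real.pi / b) ^ ((d : ℝ) / 2) * (1 / 2 * ∑ j, α j ^ 2) ≤
      ∫ ω, Real.exp (-b * ‖ω‖ ^ 2) * FF x α ω ∧
    ∫ ω, Real.exp (-b * ‖ω‖ ^ 2) * FF x α ω ≤
      (Real.pi / b) ^ ((d : ℝ) / 2) * (3 / 2 * ∑ j, α j ^ 2) := by
  obtain ⟨b₀, hb₀, h⟩ := packing2 d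
  refine ⟨b₀, hb₀, fun n x q hq hx α b hb hbq => ?_⟩
  have := schur (fun j k => Real.exp (-‖x j - x k‖ ^ 2 / (4 * b))) (fun _ _ => (Real.exp_pos _).le)
    (fun j => by simp) (fun j k => by rw [norm_sub_rev]) (h n x q hq hx b hb hbq) α
  rw [abs_le] at this
  have hp : 0 < Real.pi / b := div_pos Real.pi_pos hb
  rw [gauss_form x α hb]
  constructor
  · gcongr
    linarith
  · gcongr
    linarith

lemma integrable_w {d : ℕ} {τ : ℝ} (hτ : (d : ℝ) / 2 < τ) :
    Integrable (fun ω : EuclideanSpace ℝ (Fin d) => (1 + ‖ω‖ ^ 2) ^ (-τ)) := by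
  have := integrable_rpow_neg_one_add_norm_sq (E := EuclideanSpace ℝ (Fin d)) (μ := volume)
    (r := 2 * τ) (by simp; linarith)
  simpa [neg_div] using this

lemma shell_bound {d n : ℕ} {τ : ℝ} (hτ : (d : ℝ) / 2 < τ)
    (x : Fin n → EuclideanSpace ℝ (Fin d)) (α : Fin n → ℝ) (N ρ : ℝ) (hρ : 0 < ρ)
    (H : ∫ ω, Real.exp (-(1 / ρ ^ 2) * ‖ω‖ ^ 2) * FF x α ω ≤
      (Real.pi / (1 / ρ ^ 2)) ^ ((d : ℝ) / 2) * N) :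
    ∫ ω in norm ⁻¹' Set.Ico ρ (2 * ρ), (1 + ‖ω‖ ^ 2) ^ (-τ) * FF x α ω ≤
      Real.exp 4 * Real.pi ^ ((d : ℝ) / 2) * N * ρ ^ (-(2 * τ - d)) := by
  have hτ0 : 0 < τ := lt_of_le_of_lt (by positivity) hτ
  have hG : Integrable (fun ω => Real.exp (-(1 / ρ ^ 2) * ‖ω‖ ^ 2) * FF x α ω) :=
    integrable_mul_FF x α (integrable_gauss (by positivity))
  have hGi := hG.const_mul (ρ ^ (-(2 * τ)) * Real.exp 4)
  calc ∫ ω in norm ⁻¹' Set.Ico ρ (2 * ρ), (1 + ‖ω‖ ^ 2) ^ (-τ) * FF x α ω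
      ≤ ∫ ω in norm ⁻¹' Set.Ico ρ (2 * ρ), ρ ^ (-(2 * τ)) * Real.exp 4 *
          (Real.exp (-(1 / ρ ^ 2) * ‖ω‖ ^ 2) * FF x α ω) := by
        refine setIntegral_mono_on (integrable_mul_FF x α (integrable_w hτ)).integrableOn
          hGi.integrableOn (measurable_norm measurableSet_Ico) fun ω hω => ?_
        obtain ⟨h1, h2⟩ := hω
        rw [← mul_assoc]
        refine mul_le_mul_of_nonneg_right ?_ (FF_nonneg ..)
        rw [mul_assoc, ← Real.exp_add]
        have e1 : (1 + ‖ω‖ ^ 2) ^ (-τ) ≤ ρ ^ (-(2 * τ)) := by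
          have : ρ ^ (-(2 * τ)) = (ρ ^ 2) ^ (-τ) := by
            rw [← Real.rpow_natCast, ← Real.rpow_mul hρ.le]
            congr 1; push_cast; ring
          rw [this]
          apply Real.rpow_le_rpow_of_nonpos (by positivity) _ (by linarith)
          nlinarith
        have e2 : 1 ≤ Real.exp (4 + -(1 / ρ ^ 2) * ‖ω‖ ^ 2) := by
          apply Real.one_le_exp
          have : ‖ω‖ ^ 2 / ρ ^ 2 ≤ 4 := by
            rw [div_le_iff₀ (by positivity)]
            nlinarith [norm_nonneg ω]
          have e : -(1 / ρ ^ 2) * ‖ω‖ ^ 2 = -(‖ω‖ ^ 2 / ρ ^ 2) := by ring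
          rw [e]; linarith
        calc _ ≤ ρ ^ (-(2 * τ)) := e1
          _ ≤ _ := le_mul_of_one_le_right (by positivity) e2
    _ ≤ ∫ ω, ρ ^ (-(2 * τ)) * Real.exp 4 *
          (Real.exp (-(1 / ρ ^ 2) * ‖ω‖ ^ 2) * FF x α ω) := by
        refine setIntegral_le_integral hGi (Filter.Eventually.of_forall fun ω => ?_)
        have := FF_nonneg x α ω
        simp only [Pi.zero_apply]
        positivity
    _ ≤ ρ ^ (-(2 * τ)) * Real.exp 4 * ((Real.pi / (1 / ρ ^ 2)) ^ ((d : ℝ) / 2) * N) := by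
        rw [integral_const_mul]
        gcongr
    _ = _ := by
        have : (Real.pi / (1 / ρ ^ 2)) ^ ((d : ℝ) / 2) = Real.pi ^ ((d : ℝ) / 2) * ρ ^ (d : ℝ) := by
          rw [div_div_eq_mul_div, div_one, Real.mul_rpow Real.pi_pos.le (by positivity)]
          congr 1
          rw [← Real.rpow_natCast, ← Real.rpow_mul hρ.le]
          congr 1; push_cast; ring
        have h3 : ρ ^ (-(2 * τ - d)) = ρ ^ (-(2 * τ)) * ρ ^ (d : ℝ) := by
          rw [← Real.rpow_add hρ]; congr 1; ring
        rw [this, h3]; ring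

lemma tail_bound {d n : ℕ} {τ : ℝ} (hτ : (d : ℝ) / 2 < τ)
    (x : Fin n → EuclideanSpace ℝ (Fin d)) (α : Fin n → ℝ) (N B ρ : ℝ) (hρ : 0 < ρ)
    (hB : 1 / ρ ^ 2 ≤ B)
    (H : ∀ b, 0 < b → b ≤ B → ∫ ω, Real.exp (-b * ‖ω‖ ^ 2) * FF x α ω ≤
      (Real.pi / b) ^ ((d : ℝ) / 2) * N) :
    ∫ ω in (Metric.ball 0 ρ)ᶜ, (1 + ‖ω‖ ^ 2) ^ (-τ) * FF x α ω ≤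
      Real.exp 4 * Real.pi ^ ((d : ℝ) / 2) * N * (1 - 2 ^ (-(2 * τ - d)))⁻¹ *
        ρ ^ (-(2 * τ - d)) := by
  set s : ℕ → Set (EuclideanSpace ℝ (Fin d)) :=
    fun k => norm ⁻¹' Set.Ico (ρ * 2 ^ k) (ρ * 2 ^ (k + 1)) with hs
  have hU : (Metric.ball (0 : EuclideanSpace ℝ (Fin d)) ρ)ᶜ = ⋃ k, s k := by
    ext ω
    simp only [Set.mem_compl_iff, mem_ball_zero_iff, not_lt, Set.mem_iUnion, hs, Set.mem_preimage,
      Set.mem_Ico]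
    constructor
    · intro h
      obtain ⟨k, h1, h2⟩ := exists_nat_pow_near (x := ‖ω‖ / ρ) (y := 2)
        (by rwa [le_div_iff₀ hρ, one_mul]) (by norm_num)
      rw [le_div_iff₀ hρ] at h1
      rw [div_lt_iff₀ hρ] at h2
      exact ⟨k, by linarith, by linarith⟩
    · rintro ⟨k, h1, -⟩
      exact (le_mul_of_one_le_right hρ.le (one_le_pow₀ (by norm_num))).trans h1
  have hmono : Monotone (fun k : ℕ => ρ * 2 ^ k) := fun i j hij => by
    dsimp only
    gcongr
    norm_num
  have hd : Pairwise (Function.onFun Disjoint s) := fun i j hij =>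
    (hmono.pairwise_disjoint_on_Ico_succ hij).preimage _
  have hsum := hasSum_integral_iUnion (μ := volume) (fun k => measurable_norm measurableSet_Ico) hd
    (integrable_mul_FF x α (integrable_w hτ)).integrableOn
  rw [hU]
  have hp : (2 : ℝ) ^ (-(2 * τ - d)) < 1 :=
    Real.rpow_lt_one_of_one_lt_of_neg (by norm_num) (by linarith)
  have hg := (hasSum_geometric_of_lt_one (by positivity) hp).mul_left
    (Real.exp 4 * Real.pi ^ ((d : ℝ) / 2) * N * ρ ^ (-(2 * τ - d)))
  refine (hasSum_le (fun k => ?_) hsum hg).trans_eq (by ring)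
  have hk : 0 < ρ * 2 ^ k := by positivity
  have := shell_bound hτ x α N (ρ * 2 ^ k) hk (H _ (by positivity) (le_trans ?_ hB))
  · have e : s k = norm ⁻¹' Set.Ico (ρ * 2 ^ k) (2 * (ρ * 2 ^ k)) := by
      simp only [hs]; congr 2; ring
    rw [← e] at this
    refine this.trans_eq ?_
    rw [Real.mul_rpow hρ.le (by positivity), ← Real.rpow_natCast 2 k, ← Real.rpow_mul (by norm_num),
      mul_comm (k : ℝ), Real.rpow_mul (by norm_num), Real.rpow_natCast]
    ring
  · gcongr
    exact le_mul_of_one_le_right hρ.le (one_le_pow₀ (by norm_num))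

lemma full_bound {d n : ℕ} {τ : ℝ} (hτ : (d : ℝ) / 2 < τ)
    (x : Fin n → EuclideanSpace ℝ (Fin d)) (α : Fin n → ℝ) (N r K : ℝ) (hr : 0 < r) (hK : 0 < K)
    (hN : 0 ≤ N) (hrK : 1 + r ^ 2 ≤ K * r ^ 2)
    (H : (Real.pi / (τ / r ^ 2)) ^ ((d : ℝ) / 2) * N ≤
      ∫ ω, Real.exp (-(τ / r ^ 2) * ‖ω‖ ^ 2) * FF x α ω) :
    K ^ (-τ) * (Real.pi / τ) ^ ((d : ℝ) / 2) * N * r ^ (-(2 * τ - d)) ≤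
      ∫ ω, (1 + ‖ω‖ ^ 2) ^ (-τ) * FF x α ω := by
  have hτ0 : 0 < τ := lt_of_le_of_lt (by positivity) hτ
  have hG : Integrable (fun ω => Real.exp (-(τ / r ^ 2) * ‖ω‖ ^ 2) * FF x α ω) :=
    integrable_mul_FF x α (integrable_gauss (by positivity))
  calc K ^ (-τ) * (Real.pi / τ) ^ ((d : ℝ) / 2) * N * r ^ (-(2 * τ - d))
      = (K * r ^ 2) ^ (-τ) * ((Real.pi / (τ / r ^ 2)) ^ ((d : ℝ) / 2) * N) := by
        have h1 : Real.pi / (τ / r ^ 2) = Real.pi / τ * r ^ 2 := by field_simp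
        rw [h1, Real.mul_rpow hK.le (by positivity), Real.mul_rpow (by positivity) (by positivity),
          ← Real.rpow_natCast r 2, ← Real.rpow_mul hr.le, ← Real.rpow_mul hr.le]
        have h3 : r ^ (-(2 * τ - d)) = r ^ (((2 : ℕ) : ℝ) * -τ) * r ^ (((2 : ℕ) : ℝ) * (d / 2)) := by
          rw [← Real.rpow_add hr]; congr 1; push_cast; ring
        rw [h3]; ring
    _ ≤ (K * r ^ 2) ^ (-τ) * ∫ ω, Real.exp (-(τ / r ^ 2) * ‖ω‖ ^ 2) * FF x α ω := by gcongr
    _ = ∫ ω, (K * r ^ 2) ^ (-τ) * (Real.exp (-(τ / r ^ 2) * ‖ω‖ ^ 2) * FF x α ω) := by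
        rw [integral_const_mul]
    _ ≤ _ := by
        refine integral_mono (hG.const_mul _) (integrable_mul_FF x α (integrable_w hτ)) fun ω => ?_
        dsimp only
        rw [← mul_assoc]
        refine mul_le_mul_of_nonneg_right ?_ (FF_nonneg ..)
        have e : Real.exp (-(τ / r ^ 2) * ‖ω‖ ^ 2) = (Real.exp (‖ω‖ ^ 2 / r ^ 2)) ^ (-τ) := by
          rw [← Real.exp_mul]; congr 1; ring
        rw [e, ← Real.mul_rpow (by positivity) (by positivity)]
        apply Real.rpow_le_rpow_of_nonpos (by positivity) _ (by linarith)
        have h1 := Real.add_one_le_exp (‖ω‖ ^ 2 / r ^ 2)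
        calc 1 + ‖ω‖ ^ 2 ≤ (1 + r ^ 2) * (‖ω‖ ^ 2 / r ^ 2 + 1) := by
              have : (1 + r ^ 2) * (‖ω‖ ^ 2 / r ^ 2 + 1) =
                1 + ‖ω‖ ^ 2 + (‖ω‖ ^ 2 / r ^ 2 + r ^ 2) := by field_simp; ring
              rw [this]
              have : 0 ≤ ‖ω‖ ^ 2 / r ^ 2 + r ^ 2 := by positivity
              linarith
          _ ≤ _ := by gcongr

theorem stmt_9 {d : ℕ} (τ : ℝ) (hτ : (d : ℝ) / 2 < τ)
    (Ω : Set (EuclideanSpace ℝ (Fin d))) (hΩ : Bornology.IsBounded Ω)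
    (ε : ℝ) (hε : ε ∈ Set.Ioo (0 : ℝ) 1) :
    ∃ a : ℝ, 0 < a ∧
      ∀ (n : ℕ) (x : Fin n → EuclideanSpace ℝ (Fin d)), Function.Injective x →
        (∀ j, x j ∈ Ω) →
        ∀ qX : ℝ, IsLeast {r | ∃ i j, i ≠ j ∧ r = dist (x i) (x j)} qX →
        ∀ (α : Fin n → ℝ) (R : ℝ), max a Real.pi / qX ≤ R →
          (1 - ε) *
              ∫ ω : EuclideanSpace ℝ (Fin d),
                (1 + ‖ω‖ ^ 2) ^ (-τ) *
                  ‖∑ j, (α j : ℂ) * Complex.exp (Complex.I * ((⟪ω, x j⟫_ℝ : ℝ) : ℂ))‖ ^ 2 ≤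
            ∫ ω in Metric.ball (0 : EuclideanSpace ℝ (Fin d)) (2 * R),
              (1 + ‖ω‖ ^ 2) ^ (-τ) *
                ‖∑ j, (α j : ℂ) * Complex.exp (Complex.I * ((⟪ω, x j⟫_ℝ : ℝ) : ℂ))‖ ^ 2 := by
  have hτ0 : 0 < τ := lt_of_le_of_lt (by positivity) hτ
  obtain ⟨b₀, hb₀, hb⟩ := gauss_bounds d
  obtain ⟨D, hD0, hD⟩ : ∃ D : ℝ, 0 < D ∧ ∀ u ∈ Ω, ∀ v ∈ Ω, dist u v ≤ D := by
    obtain ⟨D, hD⟩ := Metric.isBounded_iff.1 hΩ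
    exact ⟨max D 1, by positivity, fun u hu v hv => (hD hu hv).trans (le_max_left _ _)⟩
  set p : ℝ := 2 * τ - d with hp
  have hp0 : 0 < p := by rw [hp]; linarith
  set r₁ : ℝ := Real.sqrt (τ / b₀) with hr₁
  have hr₁0 : 0 < r₁ := Real.sqrt_pos.2 (by positivity)
  have hr₁sq : r₁ ^ 2 = τ / b₀ := Real.sq_sqrt (by positivity)
  set K : ℝ := 1 + D ^ 2 / r₁ ^ 2 with hK
  have hK0 : 0 < K := by positivity
  set C₁ : ℝ := Real.exp 4 * Real.pi ^ ((d : ℝ) / 2) * (1 - 2 ^ (-p))⁻¹ * (3 / 2) with hC₁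
  set C₂ : ℝ := K ^ (-τ) * (Real.pi / τ) ^ ((d : ℝ) / 2) * r₁ ^ (-p) * (1 / 2) with hC₂
  have hpi := Real.pi_pos
  have hC₂0 : 0 < C₂ := by positivity
  have hC₁0 : 0 < C₁ := by
    have : (2 : ℝ) ^ (-p) < 1 := Real.rpow_lt_one_of_one_lt_of_neg (by norm_num) (by linarith)
    have : 0 < (1 - (2 : ℝ) ^ (-p))⁻¹ := inv_pos.2 (by linarith)
    positivity
  obtain ⟨a, ha0, ha1, ha2⟩ : ∃ a : ℝ, 0 < a ∧ 1 / a ^ 2 ≤ b₀ ∧ C₁ * a ^ (-p) ≤ ε * C₂ := by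
    have h1 : ∀ᶠ a : ℝ in Filter.atTop, a ^ (-p) < ε * C₂ / C₁ :=
      (tendsto_rpow_neg_atTop hp0).eventually_lt_const (by have := hε.1; positivity)
    obtain ⟨a, h2, h3⟩ := (h1.and (Filter.eventually_ge_atTop (max 1 (1 / b₀)))).exists
    have h4 : 1 ≤ a := (le_max_left _ _).trans h3
    have h5 : 1 / b₀ ≤ a := (le_max_right _ _).trans h3
    refine ⟨a, by linarith, ?_, ?_⟩
    · rw [div_le_iff₀ (by positivity)]
      rw [div_le_iff₀ hb₀] at h5
      nlinarith [mul_le_mul_of_nonneg_left h4 (by positivity : 0 ≤ b₀ * a)]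
    · rw [lt_div_iff₀ hC₁0] at h2
      linarith
  refine ⟨a, ha0, fun n x hx hxΩ q hq α R hR => ?_⟩
  change (1 - ε) * ∫ ω, (1 + ‖ω‖ ^ 2) ^ (-τ) * FF x α ω ≤
    ∫ ω in Metric.ball 0 (2 * R), (1 + ‖ω‖ ^ 2) ^ (-τ) * FF x α ω
  obtain ⟨⟨i, j, hij, hqij⟩, hlow⟩ := hq
  have hq0 : 0 < q := by rw [hqij]; exact dist_pos.2 (hx.ne hij)
  have hqD : q ≤ D := by rw [hqij]; exact hD _ (hxΩ i) _ (hxΩ j)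
  have hsep : ∀ i j, i ≠ j → q ≤ dist (x i) (x j) := fun i j h => hlow ⟨i, j, h, rfl⟩
  have hb' := hb n x q hq0 hsep α
  set A : ℝ := ∑ j, α j ^ 2 with hA
  have hA0 : 0 ≤ A := Finset.sum_nonneg fun _ _ => sq_nonneg _
  have hRa : a / q ≤ 2 * R := by
    have h1 : a / q ≤ R := le_trans (by gcongr; exact le_max_left _ _) hR
    have : 0 < a / q := by positivity
    linarith
  have haq : 0 < a / q := by positivity
  have hρ : 0 < 2 * R := haq.trans_le hRa
  have hT := tail_bound hτ x α (3 / 2 * A) (b₀ * q ^ 2) (2 * R) hρ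
    (calc 1 / (2 * R) ^ 2 ≤ 1 / (a / q) ^ 2 := by gcongr
      _ = 1 / a ^ 2 * q ^ 2 := by field_simp
      _ ≤ _ := by gcongr)
    (fun b h1 h2 => (hb' b h1 h2).2)
  have hr0 : 0 < r₁ / q := by positivity
  have hbr : τ / (r₁ / q) ^ 2 = b₀ * q ^ 2 := by
    rw [div_pow, hr₁sq]; field_simp
  have hF := full_bound hτ x α (1 / 2 * A) (r₁ / q) K hr0 hK0 (by positivity)
    (by
      have h1 : 1 ≤ D ^ 2 / r₁ ^ 2 * (r₁ / q) ^ 2 := by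
        have : D ^ 2 / r₁ ^ 2 * (r₁ / q) ^ 2 = (D / q) ^ 2 := by field_simp
        rw [this]
        exact one_le_pow₀ (by rwa [le_div_iff₀ hq0, one_mul])
      rw [hK]; linarith)
    (hb' _ (by positivity) hbr.le).1
  rw [← hp] at hT hF
  have hqp : (r₁ / q) ^ (-p) = r₁ ^ (-p) * (q⁻¹) ^ (-p) := by
    rw [div_eq_mul_inv, Real.mul_rpow (by positivity) (by positivity)]
  have hRp : (2 * R) ^ (-p) ≤ a ^ (-p) * (q⁻¹) ^ (-p) := by
    rw [← Real.mul_rpow (by positivity) (by positivity), ← div_eq_mul_inv]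
    exact Real.rpow_le_rpow_of_nonpos haq hRa (by linarith)
  have hsplit := integral_add_compl (μ := volume)
    (measurableSet_ball (x := (0 : EuclideanSpace ℝ (Fin d))) (ε := 2 * R))
    (integrable_mul_FF x α (integrable_w hτ))
  have hfin : ∫ ω in (Metric.ball 0 (2 * R))ᶜ, (1 + ‖ω‖ ^ 2) ^ (-τ) * FF x α ω ≤
      ε * ∫ ω, (1 + ‖ω‖ ^ 2) ^ (-τ) * FF x α ω := by
    calc _ ≤ C₁ * A * (2 * R) ^ (-p) := hT.trans_eq (by rw [hC₁]; ring)
      _ ≤ C₁ * A * (a ^ (-p) * (q⁻¹) ^ (-p)) := by gcongr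
      _ = C₁ * a ^ (-p) * (A * (q⁻¹) ^ (-p)) := by ring
      _ ≤ ε * C₂ * (A * (q⁻¹) ^ (-p)) := by gcongr
      _ = ε * (K ^ (-τ) * (Real.pi / τ) ^ ((d : ℝ) / 2) * (1 / 2 * A) * (r₁ / q) ^ (-p)) := by
        rw [hC₂, hqp]; ring
      _ ≤ _ := by
        have := hε.1
        gcongr
  linarith
end

section
/- Let Ω ⊂ ℝᵈ be bounded, τ > d/2, σ ∈ (d/(2τ), 1]. Let k and k^{(σ)} be translational invariant kernels with Fourier transforms (1+‖ω‖²)^{−τ} and (1+‖ω‖²)^{−στ}, respectively. Then there is a constant c'_σ > 0 depending only on σ, d, τ, Ω such that for all finite sets X ⊂ Ω of pairwise distinct points, with A = k(X,X) and A^{(σ)} = k^{(σ)}(X,X), for all nonzero α ∈ ℝ^{|X|}: (αᵀAα)/‖α‖² ≤ (αᵀA^{(σ)}α)/‖α‖² ≤ c'_σ q_X^{−(1−σ)2τ} (αᵀAα)/‖α‖². -/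
open MeasureTheory
open scoped InnerProductSpace

namespace KQ
open scoped FourierTransform SchwartzMap

noncomputable def P {d n : ℕ} (x : Fin n → EuclideanSpace ℝ (Fin d)) (β : Fin n → ℂ)
    (ω : EuclideanSpace ℝ (Fin d)) : ℝ :=
  ‖∑ j, β j * Complex.exp (Complex.I * ((⟪ω, x j⟫_ℝ : ℝ) : ℂ))‖ ^ 2

noncomputable def w {d : ℕ} (s : ℝ) (ω : EuclideanSpace ℝ (Fin d)) : ℝ := (1 + ‖ω‖ ^ 2) ^ (-s)

variable {d n : ℕ}

lemma P_nonneg (x : Fin n → EuclideanSpace ℝ (Fin d)) (β : Fin n → ℂ) (ω) : 0 ≤ P x β ω := by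
  unfold P; positivity

lemma P_cont (x : Fin n → EuclideanSpace ℝ (Fin d)) (β : Fin n → ℂ) : Continuous (P x β) := by
  unfold P; fun_prop

lemma norm_e (a : ℝ) : ‖Complex.exp (Complex.I * (a : ℂ))‖ = 1 := by
  rw [mul_comm]; exact Complex.norm_exp_ofReal_mul_I a

lemma P_le (x : Fin n → EuclideanSpace ℝ (Fin d)) (β : Fin n → ℂ) (ω) :
    P x β ω ≤ (∑ j, ‖β j‖) ^ 2 := by
  unfold P
  gcongr
  refine (norm_sum_le _ _).trans (Finset.sum_le_sum fun j _ => ?_)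
  rw [norm_mul, norm_e, mul_one]

lemma w_pos (s : ℝ) (ω : EuclideanSpace ℝ (Fin d)) : 0 < w s ω := by unfold w; positivity

lemma w_cont (s : ℝ) : Continuous (w s : EuclideanSpace ℝ (Fin d) → ℝ) := by
  unfold w
  refine Continuous.rpow_const (by fun_prop) fun ω => Or.inl (by positivity)

lemma w_int {s : ℝ} (hs : (d : ℝ) / 2 < s) :
    Integrable (w s : EuclideanSpace ℝ (Fin d) → ℝ) := by
  have := integrable_rpow_neg_one_add_norm_sq (E := EuclideanSpace ℝ (Fin d)) (μ := volume)
    (r := 2 * s) (by simp; linarith)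
  unfold w
  convert this using 3
  ring

lemma mulP_int {g : EuclideanSpace ℝ (Fin d) → ℝ} (hg : Integrable g)
    (x : Fin n → EuclideanSpace ℝ (Fin d)) (β : Fin n → ℂ) :
    Integrable (fun ω => g ω * P x β ω) := by
  refine hg.mul_bdd (c := (∑ j, ‖β j‖) ^ 2) (P_cont x β).aestronglyMeasurable ?_
  refine Filter.Eventually.of_forall fun ω => ?_
  rw [Real.norm_of_nonneg (P_nonneg _ _ _)]
  exact P_le _ _ _

/-- shifting the frequency changes only the phases of the coefficients -/
lemma P_shift (x : Fin n → EuclideanSpace ℝ (Fin d)) (β : Fin n → ℂ) (ω η) :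
    P x β (ω + η) = P x (fun j => β j * Complex.exp (Complex.I * ((⟪η, x j⟫_ℝ : ℝ) : ℂ))) ω := by
  unfold P
  congr 2
  refine Finset.sum_congr rfl fun j _ => ?_
  rw [inner_add_left, mul_assoc, ← Complex.exp_add]
  congr 2
  push_cast; ring

lemma P_smul (x : Fin n → EuclideanSpace ℝ (Fin d)) (β : Fin n → ℂ) (ω) (q : ℝ) :
    P x β (q • ω) = P (fun j => q • x j) β ω := by
  unfold P
  simp only [inner_smul_left, inner_smul_right]
  simp

/-- Plancherel with disjoint translates -/
lemma planch (φ : 𝓢(EuclideanSpace ℝ (Fin d), ℂ)) (hc : HasCompactSupport φ)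
    (hφ : ∀ v, φ v ≠ 0 → ‖v‖ < 1 / (4 * Real.pi))
    (y : Fin n → EuclideanSpace ℝ (Fin d)) (hy : ∀ i j, i ≠ j → 1 ≤ dist (y i) (y j))
    (β : Fin n → ℂ) :
    ∫ ω, ‖𝓕 φ ω‖ ^ 2 * P y β ω = (∫ v, ‖φ v‖ ^ 2) * ∑ j, ‖β j‖ ^ 2 := by
  have hpi := Real.pi_pos
  set z : Fin n → EuclideanSpace ℝ (Fin d) := fun j => (1 / (2 * Real.pi)) • y j with hz
  let g : EuclideanSpace ℝ (Fin d) → ℂ := fun v => ∑ j, β j * φ (v + z j)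
  have hcj : ∀ j, HasCompactSupport (fun v => φ (v + z j)) := fun j =>
    hc.comp_homeomorph (Homeomorph.addRight (z j))
  have gs : HasCompactSupport g := by
    have : ∀ s : Finset (Fin n), HasCompactSupport (fun v => ∑ j ∈ s, β j * φ (v + z j)) := by
      intro s
      induction s using Finset.induction_on with
      | empty =>
        simp only [Finset.sum_empty]
        exact HasCompactSupport.zero
      | insert a s ha ih =>
        simp only [Finset.sum_insert ha]
        exact ((hcj a).mul_left (f := fun _ => β a)).add ih
    exact this _
  have gd : ContDiff ℝ (⊤ : ℕ∞) g := by
    refine ContDiff.sum fun j _ => ?_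
    have := φ.smooth (⊤ : ℕ∞)
    fun_prop
  let G : 𝓢(EuclideanSpace ℝ (Fin d), ℂ) := gs.toSchwartzMap gd
  have key := SchwartzMap.integral_norm_sq_fourier G
  have hint : ∀ j, Integrable (fun v => φ (v + z j)) := fun j => φ.integrable.comp_add_right (z j)
  have hF : ∀ ω, 𝓕 G ω = 𝓕 φ ω * ∑ j, β j * Complex.exp (Complex.I * ((⟪ω, y j⟫_ℝ : ℝ) : ℂ)) := by
    intro ω
    have hG : (G : EuclideanSpace ℝ (Fin d) → ℂ) = g := rfl
    rw [SchwartzMap.fourier_coe, SchwartzMap.fourier_coe, hG]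
    have h1 : ∀ j, 𝓕 (fun v => φ (v + z j)) ω
        = Complex.exp (Complex.I * ((⟪ω, y j⟫_ℝ : ℝ) : ℂ)) * 𝓕 (φ : EuclideanSpace ℝ (Fin d) → ℂ) ω := by
      intro j
      have := congrFun (VectorFourier.fourierIntegral_comp_add_right Real.fourierChar volume
        (innerₗ (EuclideanSpace ℝ (Fin d))) (φ : EuclideanSpace ℝ (Fin d) → ℂ) (z j)) ω
      rw [Real.fourier_eq, Real.fourier_eq]
      simp only [VectorFourier.fourierIntegral, Function.comp_def, innerₗ_apply_apply] at this
      rw [this, Circle.smul_def, Real.fourierChar_apply, smul_eq_mul]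
      congr 2
      have h3 : ⟪z j, ω⟫_ℝ = 1 / (2 * Real.pi) * ⟪ω, y j⟫_ℝ := by
        rw [real_inner_comm, hz, real_inner_smul_right]
      rw [h3, show 2 * Real.pi * (1 / (2 * Real.pi) * ⟪ω, y j⟫_ℝ) = ⟪ω, y j⟫_ℝ by field_simp,
        mul_comm]
    rw [Finset.mul_sum]
    have h2 : 𝓕 g ω = ∑ j, β j * 𝓕 (fun v => φ (v + z j)) ω := by
      simp only [Real.fourier_eq]
      rw [← Finset.sum_congr rfl (fun j _ => integral_const_mul (β j) _), ← integral_finsetSum]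
      · congr 1
        ext v
        simp only [g, Finset.smul_sum, Circle.smul_def, smul_eq_mul]
        refine Finset.sum_congr rfl fun j _ => ?_
        ring
      · intro j _
        refine Integrable.const_mul ?_ _
        exact (Real.fourierIntegral_convergent_iff ω).2 (hint j)
    rw [h2]
    refine Finset.sum_congr rfl fun j _ => ?_
    rw [h1]; ring
  have hL : ∫ ω, ‖𝓕 φ ω‖ ^ 2 * P y β ω = ∫ ω, ‖𝓕 G ω‖ ^ 2 := by
    congr 1; ext ω
    rw [hF, norm_mul, mul_pow]; rfl
  rw [hL, key]
  have hpt : ∀ v, ‖G v‖ ^ 2 = ∑ j, ‖β j‖ ^ 2 * ‖φ (v + z j)‖ ^ 2 := by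
    intro v
    change ‖∑ j, β j * φ (v + z j)‖ ^ 2 = _
    by_cases hv : ∃ j, φ (v + z j) ≠ 0
    · obtain ⟨j, hj⟩ := hv
      have hoth : ∀ i, i ≠ j → φ (v + z i) = 0 := by
        intro i hij
        by_contra hi
        have a := hφ _ hj
        have b := hφ _ hi
        have c : dist (z i) (z j) = 1 / (2 * Real.pi) * dist (y i) (y j) := by
          simp only [hz, dist_smul₀]
          rw [Real.norm_of_nonneg (by positivity)]
        have e : dist (z i) (z j) < 1 / (4 * Real.pi) + 1 / (4 * Real.pi) := by
          rw [dist_eq_norm, show z i - z j = (v + z i) - (v + z j) by abel]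
          exact (norm_sub_le _ _).trans_lt (by linarith)
        have f : 1 / (4 * Real.pi) + 1 / (4 * Real.pi) = 1 / (2 * Real.pi) * 1 := by
          field_simp; norm_num
        rw [f, c] at e
        have := lt_of_mul_lt_mul_left e (by positivity)
        linarith [hy i j hij]
      rw [Finset.sum_eq_single j, Finset.sum_eq_single j, norm_mul, mul_pow]
      · intro i _ hi; simp [hoth i hi]
      · simp
      · intro i _ hi; simp [hoth i hi]
      · simp
    · push Not at hv
      simp [hv]
  have hsq : ∀ j, Integrable (fun v => ‖φ (v + z j)‖ ^ 2) := by
    intro j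
    have : Integrable (fun v => ‖φ v‖ ^ 2) := by
      have := (φ.memLp 2 (volume)).integrable_norm_pow (by norm_num)
      simpa using this
    exact this.comp_add_right (z j)
  simp only [hpt]
  rw [integral_finsetSum _ fun j _ => (hsq j).const_mul _, Finset.mul_sum]
  refine Finset.sum_congr rfl fun j _ => ?_
  rw [integral_const_mul, integral_add_right_eq_self (fun v => ‖φ v‖ ^ 2), mul_comm]


lemma exists_h (d : ℕ) (s : ℝ) : ∃ (h : EuclideanSpace ℝ (Fin d) → ℝ) (H C r c N : ℝ),
    Continuous h ∧ Integrable h ∧ (∀ ω, 0 ≤ h ω) ∧ 0 < H ∧ (∀ ω, h ω ≤ H) ∧ 0 < C ∧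
    (∀ ω, h ω ≤ C * w (s + 1) ω) ∧ 0 < r ∧ r ≤ 1 ∧ 0 < c ∧ (∀ ω, ‖ω‖ ≤ r → c ≤ h ω) ∧ 0 < N ∧
    ∀ (n : ℕ) (y : Fin n → EuclideanSpace ℝ (Fin d)), (∀ i j, i ≠ j → 1 ≤ dist (y i) (y j)) →
    ∀ β : Fin n → ℂ, ∫ ω, h ω * P y β ω = N * ∑ j, ‖β j‖ ^ 2 := by
  have hpi := Real.pi_pos
  let b : ContDiffBump (0 : EuclideanSpace ℝ (Fin d)) :=
    ⟨1 / (8 * Real.pi), 1 / (4 * Real.pi), by positivity, by gcongr; norm_num⟩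
  have hbc : HasCompactSupport (fun v => ((b v : ℝ) : ℂ)) :=
    b.hasCompactSupport.comp_left (g := fun t : ℝ => (t : ℂ)) (by simp)
  have hbd : ContDiff ℝ (⊤ : ℕ∞) (fun v => ((b v : ℝ) : ℂ)) :=
    Complex.ofRealCLM.contDiff.comp b.contDiff
  let φ : 𝓢(EuclideanSpace ℝ (Fin d), ℂ) := hbc.toSchwartzMap hbd
  have hφ : ∀ v, φ v = ((b v : ℝ) : ℂ) := fun v => rfl
  have hsupp : ∀ v, φ v ≠ 0 → ‖v‖ < 1 / (4 * Real.pi) := by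
    intro v hv
    have : v ∈ Function.support b := by
      rw [hφ] at hv
      simpa using hv
    rw [b.support_eq, mem_ball_zero_iff] at this
    exact this
  have hc : Continuous (fun ω => ‖𝓕 φ ω‖ ^ 2) := by
    have := (𝓕 φ).continuous
    fun_prop
  have h0 : 0 < ‖𝓕 φ 0‖ ^ 2 := by
    have : 𝓕 φ 0 = ((∫ v, b v : ℝ) : ℂ) := by
      rw [SchwartzMap.fourier_coe, Real.fourier_eq]
      simp only [inner_zero_right, neg_zero, AddChar.map_zero_eq_one, one_smul, hφ]
      exact integral_ofReal
    rw [this]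
    have := b.integral_pos (μ := volume)
    have : ((∫ v, b v : ℝ) : ℂ) ≠ 0 := by exact_mod_cast this.ne'
    positivity
  have hN : 0 < ∫ v, ‖φ v‖ ^ 2 := by
    refine Continuous.integral_pos_of_hasCompactSupport_nonneg_nonzero (x := 0) ?_ ?_ ?_ ?_
    · have := φ.continuous
      fun_prop
    · exact hbc.comp_left (g := fun t : ℂ => ‖t‖ ^ 2) (by simp)
    · intro v; positivity
    · rw [hφ, b.one_of_mem_closedBall (by simp [b.rIn_pos.le])]; simp
  obtain ⟨r, hr, hr'⟩ := Metric.eventually_nhds_iff.1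
    (hc.continuousAt.eventually (lt_mem_nhds (half_lt_self h0)))
  obtain ⟨k, hk⟩ := exists_nat_ge (s + 1)
  have hdec : ∃ C, 0 < C ∧ ∀ ω : EuclideanSpace ℝ (Fin d), (1 + ‖ω‖) ^ k * ‖𝓕 φ ω‖ ≤ C := by
    refine ⟨2 ^ k * ((Finset.Iic (k, 0)).sup fun m => SchwartzMap.seminorm ℝ m.1 m.2) (𝓕 φ) + 1,
      by positivity, fun ω => ?_⟩
    have := SchwartzMap.one_add_le_sup_seminorm_apply (𝕜 := ℝ) (m := (k, 0)) le_rfl le_rfl (𝓕 φ) ω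
    rw [norm_iteratedFDeriv_zero] at this
    exact this.trans (by simp)
  obtain ⟨C, hC, hCle⟩ := hdec
  have hwle : ∀ ω : EuclideanSpace ℝ (Fin d), ‖𝓕 φ ω‖ ^ 2 ≤ C ^ 2 * w (s + 1) ω := by
    intro ω
    have h1 : (1 + ‖ω‖ ^ 2) ^ k * ‖𝓕 φ ω‖ ^ 2 ≤ C ^ 2 := by
      calc (1 + ‖ω‖ ^ 2) ^ k * ‖𝓕 φ ω‖ ^ 2 ≤ ((1 + ‖ω‖) ^ 2) ^ k * ‖𝓕 φ ω‖ ^ 2 := by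
            gcongr; nlinarith [norm_nonneg ω]
        _ = ((1 + ‖ω‖) ^ k * ‖𝓕 φ ω‖) ^ 2 := by rw [mul_pow, ← pow_mul, ← pow_mul, mul_comm k]
        _ ≤ C ^ 2 := by gcongr; exact hCle ω
    have h2 : (1 + ‖ω‖ ^ 2) ^ (s + 1) ≤ (1 + ‖ω‖ ^ 2) ^ k := by
      rw [← Real.rpow_natCast _ k]
      exact Real.rpow_le_rpow_of_exponent_le (le_add_of_nonneg_right (sq_nonneg ‖ω‖)) hk
    unfold w
    rw [Real.rpow_neg (by positivity), ← div_eq_mul_inv, le_div_iff₀ (by positivity), mul_comm]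
    exact le_trans (by gcongr) h1
  have hb : ∀ ω : EuclideanSpace ℝ (Fin d), ‖𝓕 φ ω‖ ^ 2 ≤ C ^ 2 := by
    intro ω
    gcongr
    refine le_trans ?_ (hCle ω)
    exact le_mul_of_one_le_left (norm_nonneg _) (one_le_pow₀ (by linarith [norm_nonneg ω]))
  refine ⟨fun ω => ‖𝓕 φ ω‖ ^ 2, C ^ 2, C ^ 2, min (r / 2) 1, ‖𝓕 φ 0‖ ^ 2 / 2, ∫ v, ‖φ v‖ ^ 2,
    hc, ?_, fun ω => by positivity, by positivity, hb, by positivity, hwle, by positivity,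
    min_le_right _ _, by positivity, ?_, hN, fun n y hy β => planch φ hbc hsupp y hy β⟩
  · have := ((𝓕 φ).memLp 2 (volume)).integrable_norm_pow (by norm_num)
    simpa using this
  · intro ω hω
    refine (hr' ?_).le
    rw [dist_zero_right]
    have := hω.trans (min_le_left _ _)
    linarith

lemma upper (d : ℕ) (s : ℝ) (hs : (d : ℝ) / 2 < s) : ∃ C : ℝ, 0 < C ∧
    ∀ (n : ℕ) (y : Fin n → EuclideanSpace ℝ (Fin d)), (∀ i j, i ≠ j → 1 ≤ dist (y i) (y j)) →
    ∀ β : Fin n → ℂ, ∫ ω, w s ω * P y β ω ≤ C * ∑ j, ‖β j‖ ^ 2 := by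
  obtain ⟨h, H, C, r, c, N, hcont, hint, hnn, hH, hHle, hC, hCle, hr, hr1, hc, hcle, hN, key⟩ :=
    exists_h d s
  have hs0 : 0 < s := lt_of_le_of_lt (by positivity) hs
  set B : ℝ := volume.real (Metric.closedBall (0 : EuclideanSpace ℝ (Fin d)) r) with hB
  have hBpos : 0 < B := ENNReal.toReal_pos (Metric.measure_closedBall_pos _ _ hr).ne'
    measure_closedBall_lt_top.ne
  have hwI : 0 < ∫ η : EuclideanSpace ℝ (Fin d), w s η :=
    (integral_pos_iff_support_of_nonneg (fun η => (w_pos s η).le) (w_int hs)).2 (by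
      rw [show Function.support (w s : EuclideanSpace ℝ (Fin d) → ℝ) = Set.univ from
        Set.eq_univ_of_forall fun η => (w_pos s η).ne']
      exact Measure.measure_univ_pos.2 (NeZero.ne _))
  set K : ℝ := B * (3 ^ (-s) * c) with hK
  have hKpos : 0 < K := by positivity
  refine ⟨(∫ η : EuclideanSpace ℝ (Fin d), w s η) * N / K, by positivity, fun n y hy β => ?_⟩
  -- convolution lower bound
  have hconvint : Integrable (fun p : EuclideanSpace ℝ (Fin d) × EuclideanSpace ℝ (Fin d) =>
      w s p.2 * h (p.1 - p.2)) (volume.prod volume) :=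
    (w_int hs).convolution_integrand (ContinuousLinearMap.mul ℝ ℝ) hint
  have hfull : Integrable (fun p : EuclideanSpace ℝ (Fin d) × EuclideanSpace ℝ (Fin d) =>
      w s p.2 * h (p.1 - p.2) * P y β p.1) (volume.prod volume) := by
    refine hconvint.mul_bdd (c := (∑ j, ‖β j‖) ^ 2)
      ((P_cont y β).comp continuous_fst).aestronglyMeasurable ?_
    refine Filter.Eventually.of_forall fun ω => ?_
    rw [Real.norm_of_nonneg (P_nonneg _ _ _)]
    exact P_le _ _ _
  have hpt : ∀ ω : EuclideanSpace ℝ (Fin d), K * w s ω ≤ ∫ η, w s η * h (ω - η) := by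
    intro ω
    have hI : Integrable (fun η => w s η * h (ω - η)) := by
      refine (w_int hs).mul_bdd (c := H) (by fun_prop) (Filter.Eventually.of_forall fun η => ?_)
      rw [Real.norm_of_nonneg (hnn _)]; exact hHle _
    have h1 : ∫ η in Metric.closedBall ω r, (3 ^ (-s) * w s ω * c)
        ≤ ∫ η in Metric.closedBall ω r, w s η * h (ω - η) := by
      refine setIntegral_mono_on (integrableOn_const measure_closedBall_lt_top.ne) hI.integrableOn measurableSet_closedBall
        fun η hη => ?_
      have hd : ‖ω - η‖ ≤ r := by
        rw [← dist_eq_norm, dist_comm]; exact hη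
      have h2 : 3 ^ (-s) * w s ω ≤ w s η := by
        unfold w
        rw [← Real.mul_rpow (by norm_num) (by positivity)]
        refine Real.rpow_le_rpow_of_nonpos (by positivity) ?_ (by linarith)
        have : ‖η‖ ≤ ‖ω‖ + 1 := by
          have := norm_sub_norm_le η ω
          rw [norm_sub_rev] at this
          linarith
        nlinarith [norm_nonneg η, norm_nonneg ω, sq_nonneg (‖ω‖ - 1)]
      exact mul_le_mul h2 (hcle _ hd) hc.le (w_pos _ _).le
    have h3 : ∫ η in Metric.closedBall ω r, w s η * h (ω - η) ≤ ∫ η, w s η * h (ω - η) :=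
      setIntegral_le_integral hI (Filter.Eventually.of_forall fun η =>
        mul_nonneg (w_pos _ _).le (hnn _))
    rw [setIntegral_const, smul_eq_mul] at h1
    have h4 : volume.real (Metric.closedBall ω r) = B := by
      rw [hB, measureReal_def, measureReal_def, Measure.addHaar_closedBall_center]
    rw [h4] at h1
    calc K * w s ω = B * (3 ^ (-s) * w s ω * c) := by rw [hK]; ring
      _ ≤ _ := h1.trans h3
  have hswap := integral_integral_swap (f := fun ω η => w s η * h (ω - η) * P y β ω) hfull
  have hL : K * ∫ ω, w s ω * P y β ω ≤ ∫ ω, ∫ η, w s η * h (ω - η) * P y β ω := by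
    rw [← integral_const_mul]
    refine integral_mono ((mulP_int (w_int hs) y β).const_mul K) hfull.integral_prod_left
      fun ω => ?_
    simp only [integral_mul_const]
    rw [← mul_assoc]
    exact mul_le_mul_of_nonneg_right (hpt ω) (P_nonneg _ _ _)
  have hR : ∫ η, ∫ ω, w s η * h (ω - η) * P y β ω
      = (∫ η : EuclideanSpace ℝ (Fin d), w s η) * (N * ∑ j, ‖β j‖ ^ 2) := by
    rw [← integral_mul_const]
    congr 1; ext η
    simp only [mul_assoc]
    rw [integral_const_mul, ← integral_add_right_eq_self (fun ω => h (ω - η) * P y β ω) η]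
    simp only [add_sub_cancel_right, P_shift]
    rw [key n y hy]
    simp only [norm_mul, norm_e, mul_one]
  rw [hswap, hR] at hL
  rw [div_mul_eq_mul_div, le_div_iff₀ hKpos]
  linarith

lemma lower (d : ℕ) : ∃ M c : ℝ, 0 < M ∧ 0 < c ∧
    ∀ (n : ℕ) (y : Fin n → EuclideanSpace ℝ (Fin d)), (∀ i j, i ≠ j → 1 ≤ dist (y i) (y j)) →
    ∀ β : Fin n → ℂ, c * ∑ j, ‖β j‖ ^ 2 ≤ ∫ ω in Metric.closedBall 0 M, P y β ω := by
  obtain ⟨s, hs⟩ := exists_gt ((d : ℝ) / 2)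
  obtain ⟨h, H, C, r, c, N, hcont, hint, hnn, hH, hHle, hC, hCle, hr, hr1, hc, hcle, hN, key⟩ :=
    exists_h d s
  obtain ⟨U, hU, hUle⟩ := upper d s hs
  set M : ℝ := 2 * C * U / N + 1 with hM
  have hM1 : 1 ≤ M := by rw [hM]; linarith [show 0 < 2 * C * U / N by positivity]
  refine ⟨M, N / (2 * H), by linarith, by positivity, fun n y hy β => ?_⟩
  have hPi : Integrable (fun ω => (Metric.closedBall (0 : EuclideanSpace ℝ (Fin d)) M).indicator
      (P y β) ω) :=
    ((P_cont y β).continuousOn.integrableOn_compact (isCompact_closedBall 0 M)).integrable_indicator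
      measurableSet_closedBall
  have hwP := mulP_int (w_int hs) y β
  have hpt : ∀ ω, h ω * P y β ω ≤ H * (Metric.closedBall (0 : EuclideanSpace ℝ (Fin d)) M).indicator
      (P y β) ω + C / M * (w s ω * P y β ω) := by
    intro ω
    have hP := P_nonneg y β ω
    have hw := w_pos s ω
    by_cases hω : ω ∈ Metric.closedBall (0 : EuclideanSpace ℝ (Fin d)) M
    · rw [Set.indicator_of_mem hω]
      have := mul_le_mul_of_nonneg_right (hHle ω) hP
      have : 0 ≤ C / M * (w s ω * P y β ω) := by positivity
      linarith
    · rw [Set.indicator_of_notMem hω]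
      rw [mul_zero, zero_add, ← mul_assoc]
      refine mul_le_mul_of_nonneg_right ((hCle ω).trans ?_) hP
      rw [div_mul_eq_mul_div, mul_div_assoc]
      refine mul_le_mul_of_nonneg_left ?_ hC.le
      have hω' : M < ‖ω‖ := by simpa using hω
      have : w (s + 1) ω = w s ω / (1 + ‖ω‖ ^ 2) := by
        unfold w
        rw [neg_add, ← sub_eq_add_neg, Real.rpow_sub (by positivity), Real.rpow_one]
      rw [this]
      gcongr
      nlinarith
  have h1 := integral_mono (mulP_int hint y β) ((hPi.const_mul H).add (hwP.const_mul (C / M))) hpt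
  simp only [Pi.add_apply] at h1
  rw [key n y hy β, integral_add (hPi.const_mul H) (hwP.const_mul (C / M)), integral_const_mul,
    integral_const_mul, integral_indicator measurableSet_closedBall] at h1
  have h2 := hUle n y hy β
  set S := ∑ j, ‖β j‖ ^ 2
  have hS : 0 ≤ S := Finset.sum_nonneg fun j _ => by positivity
  have h3 : C / M * ∫ ω, w s ω * P y β ω ≤ N / 2 * S := by
    calc C / M * ∫ ω, w s ω * P y β ω ≤ C / M * (U * S) := by gcongr
      _ = (C * U / M) * S := by ring
      _ ≤ N / 2 * S := by
        refine mul_le_mul_of_nonneg_right ?_ hS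
        rw [div_le_iff₀ (by linarith), hM]
        have : N / 2 * (2 * C * U / N + 1) = C * U + N / 2 := by field_simp
        linarith
  rw [div_mul_eq_mul_div, div_le_iff₀ (by positivity)]
  linarith


lemma P_expand (x : Fin n → EuclideanSpace ℝ (Fin d)) (α : Fin n → ℝ) (ω) :
    ((P x (fun j => (α j : ℂ)) ω : ℝ) : ℂ) = ∑ i, ∑ j, (α i : ℂ) * (α j : ℂ) *
      Complex.exp (Complex.I * ((⟪ω, x i - x j⟫_ℝ : ℝ) : ℂ)) := by
  unfold P
  rw [Complex.ofReal_pow, ← Complex.mul_conj', map_sum, Finset.sum_mul_sum]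
  refine Finset.sum_congr rfl fun i _ => Finset.sum_congr rfl fun j _ => ?_
  rw [map_mul, ← Complex.exp_conj, map_mul, Complex.conj_ofReal, Complex.conj_ofReal,
    Complex.conj_I, mul_mul_mul_comm, ← Complex.exp_add, inner_sub_right]
  congr 2
  push_cast; ring

lemma repr (τ : ℝ) (hτ : (d : ℝ) / 2 < τ) (Φ : EuclideanSpace ℝ (Fin d) → ℝ)
    (hΦ : ∀ y, (Φ y : ℂ) =
      ((2 * Real.pi) ^ (-(d : ℝ) / 2) : ℝ) *
        ∫ ω : EuclideanSpace ℝ (Fin d),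
          ((1 + ‖ω‖ ^ 2) ^ (-τ) : ℝ) * Complex.exp (Complex.I * ((⟪ω, y⟫_ℝ : ℝ) : ℂ)))
    (x : Fin n → EuclideanSpace ℝ (Fin d)) (α : Fin n → ℝ) :
    ∑ i, ∑ j, α i * Φ (x i - x j) * α j =
      (2 * Real.pi) ^ (-(d : ℝ) / 2) * ∫ ω, w τ ω * P x (fun j => (α j : ℂ)) ω := by
  have hI : ∀ i j, Integrable (fun ω : EuclideanSpace ℝ (Fin d) => ((w τ ω : ℝ) : ℂ) *
      Complex.exp (Complex.I * ((⟪ω, x i - x j⟫_ℝ : ℝ) : ℂ))) := by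
    intro i j
    refine (w_int hτ).ofReal.mul_bdd (c := 1) (Continuous.aestronglyMeasurable (by fun_prop))
      (Filter.Eventually.of_forall fun ω => ?_)
    rw [norm_e]
  apply Complex.ofReal_injective
  rw [Complex.ofReal_mul, ← integral_complex_ofReal]
  have h1 : ∀ ω, ((w τ ω * P x (fun j => (α j : ℂ)) ω : ℝ) : ℂ) = ∑ i, ∑ j, ((α i : ℂ) * (α j : ℂ)) *
      (((w τ ω : ℝ) : ℂ) * Complex.exp (Complex.I * ((⟪ω, x i - x j⟫_ℝ : ℝ) : ℂ))) := by
    intro ω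
    rw [Complex.ofReal_mul, P_expand, Finset.mul_sum]
    refine Finset.sum_congr rfl fun i _ => ?_
    rw [Finset.mul_sum]
    exact Finset.sum_congr rfl fun j _ => by ring
  have h2 : ∫ ω, ((w τ ω * P x (fun j => (α j : ℂ)) ω : ℝ) : ℂ) = ∑ i, ∑ j, ((α i : ℂ) * (α j : ℂ)) *
      ∫ ω, (((w τ ω : ℝ) : ℂ) * Complex.exp (Complex.I * ((⟪ω, x i - x j⟫_ℝ : ℝ) : ℂ))) := by
    simp only [h1]
    rw [integral_finsetSum _ fun i _ => integrable_finsetSum _ fun j _ => (hI i j).const_mul _]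
    refine Finset.sum_congr rfl fun i _ => ?_
    rw [integral_finsetSum _ fun j _ => (hI i j).const_mul _]
    exact Finset.sum_congr rfl fun j _ => integral_const_mul _ _
  refine Eq.trans ?_ (congrArg _ h2.symm)
  push_cast [Finset.mul_sum]
  refine Finset.sum_congr rfl fun i _ => Finset.sum_congr rfl fun j _ => ?_
  rw [hΦ]
  unfold w
  push_cast
  ring

/-- pointwise comparison of the weights -/
lemma w_split {τ s D q : ℝ} (hs : 0 ≤ s) (hsτ : s ≤ τ) (hq : 0 < q) (hqD : q ≤ D)
    (ω : EuclideanSpace ℝ (Fin d)) :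
    w s ω ≤ (D ^ 2 + 1) ^ (τ - s) * q ^ (2 * s - 2 * τ) * w τ ω
      + 2 ^ s * q ^ (2 * s) * w s (q • ω) := by
  have hn : ‖q • ω‖ = q * ‖ω‖ := by rw [norm_smul, Real.norm_of_nonneg hq.le]
  have hw1 := w_pos τ ω
  have hw2 := w_pos s (q • ω)
  have hD : 0 < D := hq.trans_le hqD
  by_cases h : q * ‖ω‖ ≤ 1
  · have h1 : w s ω = (1 + ‖ω‖ ^ 2) ^ (τ - s) * w τ ω := by
      unfold w
      rw [← Real.rpow_add (by positivity)]; congr 1; ring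
    have h2 : (1 + ‖ω‖ ^ 2) ^ (τ - s) ≤ ((D ^ 2 + 1) * q ^ (-2 : ℝ)) ^ (τ - s) := by
      refine Real.rpow_le_rpow (by positivity) ?_ (by linarith)
      rw [Real.rpow_neg hq.le, ← div_eq_mul_inv, le_div_iff₀ (by positivity), Real.rpow_two]
      have : (q * ‖ω‖) ^ 2 ≤ 1 := pow_le_one₀ (by positivity) h
      have : q ^ 2 ≤ D ^ 2 := by gcongr
      nlinarith
    rw [Real.mul_rpow (by positivity) (by positivity), ← Real.rpow_mul hq.le,
      show (-2 : ℝ) * (τ - s) = 2 * s - 2 * τ by ring] at h2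
    have h3 : 0 ≤ 2 ^ s * q ^ (2 * s) * w s (q • ω) := by positivity
    have h4 := mul_le_mul_of_nonneg_right h2 hw1.le
    linarith
  · push Not at h
    have h3 : 0 ≤ (D ^ 2 + 1) ^ (τ - s) * q ^ (2 * s - 2 * τ) * w τ ω := by positivity
    have h4 : w s ω ≤ 2 ^ s * q ^ (2 * s) * w s (q • ω) := by
      have h5 : (2 : ℝ) ^ s * q ^ (2 * s) = (1 / (2 * q ^ 2)) ^ (-s) := by
        rw [one_div, Real.inv_rpow (by positivity), Real.rpow_neg (by positivity), inv_inv,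
          Real.mul_rpow (by norm_num) (by positivity), Real.rpow_mul hq.le, Real.rpow_two]
      rw [h5]
      unfold w
      rw [← Real.mul_rpow (by positivity) (by positivity), hn]
      refine Real.rpow_le_rpow_of_nonpos (by positivity) ?_ (by linarith)
      rw [div_mul_eq_mul_div, div_le_iff₀ (by positivity)]
      have : 1 ≤ (q * ‖ω‖) ^ 2 := one_le_pow₀ h.le
      nlinarith [sq_nonneg q]
    linarith

lemma w_low {τ D M q : ℝ} (hτ : 0 ≤ τ) (hq : 0 < q) (hqD : q ≤ D)
    (ξ : EuclideanSpace ℝ (Fin d)) (hξ : ‖ξ‖ ≤ M) :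
    (D ^ 2 + M ^ 2) ^ (-τ) * q ^ (2 * τ) ≤ w τ (q⁻¹ • ξ) := by
  have hn : ‖q⁻¹ • ξ‖ = q⁻¹ * ‖ξ‖ := by rw [norm_smul, Real.norm_of_nonneg (by positivity)]
  have hD : 0 < D := hq.trans_le hqD
  have h5 : q ^ (2 * τ) = (1 / q ^ 2) ^ (-τ) := by
    rw [one_div, Real.inv_rpow (by positivity), Real.rpow_neg (by positivity), inv_inv,
      Real.rpow_mul hq.le, Real.rpow_two]
  rw [h5, ← Real.mul_rpow (by positivity) (by positivity)]
  unfold w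
  rw [hn]
  refine Real.rpow_le_rpow_of_nonpos (by positivity) ?_ (by linarith)
  rw [mul_one_div, le_div_iff₀ (by positivity)]
  have : q ^ 2 ≤ D ^ 2 := by gcongr
  have : ‖ξ‖ ^ 2 ≤ M ^ 2 := by gcongr
  have : (1 + (q⁻¹ * ‖ξ‖) ^ 2) * q ^ 2 = q ^ 2 + ‖ξ‖ ^ 2 := by field_simp
  linarith

lemma compare (d : ℕ) (τ s D : ℝ) (hs : (d : ℝ) / 2 < s) (hsτ : s ≤ τ) (hD : 0 < D) :
    ∃ c : ℝ, 0 < c ∧ ∀ (n : ℕ) (x : Fin n → EuclideanSpace ℝ (Fin d)) (q : ℝ), 0 < q → q ≤ D →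
      (∀ i j, i ≠ j → q ≤ dist (x i) (x j)) → ∀ β : Fin n → ℂ,
      ∫ ω, w s ω * P x β ω ≤ c * q ^ (2 * s - 2 * τ) * ∫ ω, w τ ω * P x β ω := by
  obtain ⟨U, hU, hUle⟩ := upper d s hs
  obtain ⟨M, c, hM, hc, hcle⟩ := lower d
  have hs0 : 0 < s := lt_of_le_of_lt (by positivity) hs
  have hτ : (d : ℝ) / 2 < τ := hs.trans_le hsτ
  set E : ℝ := (D ^ 2 + M ^ 2) ^ (-τ) with hE
  have hEpos : 0 < E := by positivity
  refine ⟨(D ^ 2 + 1) ^ (τ - s) + 2 ^ s * U / (E * c), by positivity,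
    fun n x q hq hqD hsep β => ?_⟩
  set y : Fin n → EuclideanSpace ℝ (Fin d) := fun j => q⁻¹ • x j with hy
  have hysep : ∀ i j, i ≠ j → 1 ≤ dist (y i) (y j) := by
    intro i j hij
    simp only [hy, dist_smul₀]
    rw [Real.norm_of_nonneg (by positivity), ← inv_mul_cancel₀ hq.ne']
    exact mul_le_mul_of_nonneg_left (hsep i j hij) (by positivity)
  have hPy : ∀ ω, P x β ω = P y β (q • ω) := by
    intro ω
    rw [P_smul]
    congr 1
    ext1 j
    simp [hy, smul_smul, hq.ne']
  set S := ∑ j, ‖β j‖ ^ 2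
  have hS : 0 ≤ S := Finset.sum_nonneg fun j _ => by positivity
  set Q : ℝ := (q ^ d)⁻¹ with hQ
  have hQpos : 0 < Q := by positivity
  have hscale : ∀ f : EuclideanSpace ℝ (Fin d) → ℝ, ∫ ω, f (q • ω) = Q * ∫ ω, f ω := by
    intro f
    rw [Measure.integral_comp_smul_of_nonneg volume f q (hR := hq.le)]
    simp [hQ]
  set J := ∫ ω, w τ ω * P x β ω with hJ
  have hwsP := mulP_int (w_int hs) x β
  have hwtP := mulP_int (w_int hτ) x β
  have hwq : Integrable (fun ω : EuclideanSpace ℝ (Fin d) => w s (q • ω)) :=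
    (w_int hs).comp_smul hq.ne'
  have hwqP := mulP_int hwq x β
  have hb : ∫ ω, w s (q • ω) * P x β ω ≤ Q * (U * S) := by
    simp only [hPy]
    rw [hscale (fun ξ => w s ξ * P y β ξ)]
    exact mul_le_mul_of_nonneg_left (hUle n y hysep β) hQpos.le
  have hcJ : Q * (E * q ^ (2 * τ) * (c * S)) ≤ J := by
    have e1 : J = Q * ∫ ξ, w τ (q⁻¹ • ξ) * P y β ξ := by
      rw [← hscale, hJ]
      congr 1; ext ω
      rw [hPy, smul_smul, inv_mul_cancel₀ hq.ne', one_smul]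
    rw [e1]
    refine mul_le_mul_of_nonneg_left ?_ hQpos.le
    have hI : Integrable (fun ξ => w τ (q⁻¹ • ξ) * P y β ξ) :=
      mulP_int ((w_int hτ).comp_smul (inv_ne_zero hq.ne')) y β
    calc E * q ^ (2 * τ) * (c * S)
        ≤ E * q ^ (2 * τ) * ∫ ω in Metric.closedBall 0 M, P y β ω :=
          mul_le_mul_of_nonneg_left (hcle n y hysep β) (by positivity)
      _ = ∫ ω in Metric.closedBall 0 M, E * q ^ (2 * τ) * P y β ω := (integral_const_mul _ _).symm
      _ ≤ ∫ ω in Metric.closedBall 0 M, w τ (q⁻¹ • ω) * P y β ω := by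
          refine setIntegral_mono_on
            (((P_cont y β).continuousOn.integrableOn_compact
              (isCompact_closedBall 0 M)).const_mul _) hI.integrableOn
            measurableSet_closedBall fun ξ hξ => ?_
          exact mul_le_mul_of_nonneg_right
            (w_low (by linarith) hq hqD ξ (by simpa using hξ)) (P_nonneg _ _ _)
      _ ≤ _ := setIntegral_le_integral hI (Filter.Eventually.of_forall fun ξ =>
          mul_nonneg (w_pos _ _).le (P_nonneg _ _ _))
  have ha : ∫ ω, w s ω * P x β ω ≤ (D ^ 2 + 1) ^ (τ - s) * q ^ (2 * s - 2 * τ) * J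
      + 2 ^ s * q ^ (2 * s) * ∫ ω, w s (q • ω) * P x β ω := by
    rw [hJ, ← integral_const_mul, ← integral_const_mul,
      ← integral_add (hwtP.const_mul _) (hwqP.const_mul _)]
    refine integral_mono hwsP ((hwtP.const_mul _).add (hwqP.const_mul _)) fun ω => ?_
    have := mul_le_mul_of_nonneg_right (w_split hs0.le hsτ hq hqD ω) (P_nonneg x β ω)
    simp only [Pi.add_apply]
    linarith
  have hfin : 2 ^ s * q ^ (2 * s) * (Q * (U * S)) ≤
      2 ^ s * U / (E * c) * q ^ (2 * s - 2 * τ) * J := by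
    calc 2 ^ s * q ^ (2 * s) * (Q * (U * S))
        = 2 ^ s * U / (E * c) * q ^ (2 * s - 2 * τ) * (Q * (E * q ^ (2 * τ) * (c * S))) := by
          rw [Real.rpow_sub hq]
          field_simp
      _ ≤ _ := mul_le_mul_of_nonneg_left hcJ (by positivity)
  have := mul_le_mul_of_nonneg_left hb (show 0 ≤ 2 ^ s * q ^ (2 * s) by positivity)
  linarith

lemma w_mono {s τ : ℝ} (h : s ≤ τ) (ω : EuclideanSpace ℝ (Fin d)) : w τ ω ≤ w s ω :=
  Real.rpow_le_rpow_of_exponent_le (le_add_of_nonneg_right (sq_nonneg ‖ω‖)) (by linarith)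

end KQ

/-- Main result: two-sided comparison of the Rayleigh quotients of kernel matrices
for translational invariant kernels with Fourier transforms `(1+‖ω‖²)^{−τ}` and
`(1+‖ω‖²)^{−στ}`, for points in a bounded set `Ω`. -/
theorem stmt_10 {d : ℕ} (τ σ : ℝ) (hτ : (d : ℝ) / 2 < τ)
    (hσ : σ ∈ Set.Ioc ((d : ℝ) / (2 * τ)) 1)
    (Ω : Set (EuclideanSpace ℝ (Fin d))) (hΩ : Bornology.IsBounded Ω)
    (Φ Φσ : EuclideanSpace ℝ (Fin d) → ℝ)
    (hΦ : ∀ y, (Φ y : ℂ) =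
      ((2 * Real.pi) ^ (-(d : ℝ) / 2) : ℝ) *
        ∫ ω : EuclideanSpace ℝ (Fin d),
          ((1 + ‖ω‖ ^ 2) ^ (-τ) : ℝ) * Complex.exp (Complex.I * ((⟪ω, y⟫_ℝ : ℝ) : ℂ)))
    (hΦσ : ∀ y, (Φσ y : ℂ) =
      ((2 * Real.pi) ^ (-(d : ℝ) / 2) : ℝ) *
        ∫ ω : EuclideanSpace ℝ (Fin d),
          ((1 + ‖ω‖ ^ 2) ^ (-(σ * τ)) : ℝ) * Complex.exp (Complex.I * ((⟪ω, y⟫_ℝ : ℝ) : ℂ))) :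
    ∃ c : ℝ, 0 < c ∧
      ∀ (n : ℕ) (x : Fin n → EuclideanSpace ℝ (Fin d)), Function.Injective x →
        (∀ j, x j ∈ Ω) →
        ∀ qX : ℝ, IsLeast {r | ∃ i j, i ≠ j ∧ r = dist (x i) (x j)} qX →
        ∀ α : Fin n → ℝ, α ≠ 0 →
          (∑ i, ∑ j, α i * Φ (x i - x j) * α j) / (∑ j, α j ^ 2) ≤
              (∑ i, ∑ j, α i * Φσ (x i - x j) * α j) / (∑ j, α j ^ 2) ∧
            (∑ i, ∑ j, α i * Φσ (x i - x j) * α j) / (∑ j, α j ^ 2) ≤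
              c * qX ^ (-(1 - σ) * (2 * τ)) *
                ((∑ i, ∑ j, α i * Φ (x i - x j) * α j) / (∑ j, α j ^ 2)) := by
  have hτ0 : 0 < τ := lt_of_le_of_lt (by positivity) hτ
  have hs : (d : ℝ) / 2 < σ * τ := by
    have := hσ.1
    rw [div_lt_iff₀ (by positivity)] at this
    linarith
  have hsτ : σ * τ ≤ τ := mul_le_of_le_one_left hτ0.le hσ.2
  obtain ⟨D₀, hD₀⟩ := Metric.isBounded_iff.1 hΩ
  obtain ⟨c, hc, hcle⟩ := KQ.compare d τ (σ * τ) (max D₀ 1) hs hsτ (by positivity)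
  refine ⟨c, hc, fun n x hx hxΩ qX hq α _ => ?_⟩
  obtain ⟨⟨i, j, hij, hqe⟩, hmin⟩ := hq
  have hq0 : 0 < qX := by rw [hqe]; exact dist_pos.2 (hx.ne hij)
  have hqD : qX ≤ max D₀ 1 := by
    rw [hqe]; exact (hD₀ (hxΩ i) (hxΩ j)).trans (le_max_left _ _)
  rw [KQ.repr τ hτ Φ hΦ, KQ.repr (σ * τ) hs Φσ hΦσ]
  have hS : 0 ≤ ∑ j, α j ^ 2 := Finset.sum_nonneg fun j _ => sq_nonneg _
  constructor
  · refine div_le_div_of_nonneg_right ?_ hS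
    refine mul_le_mul_of_nonneg_left ?_ (by positivity)
    exact integral_mono (KQ.mulP_int (KQ.w_int hτ) _ _) (KQ.mulP_int (KQ.w_int hs) _ _)
      fun ω => mul_le_mul_of_nonneg_right (KQ.w_mono hsτ ω) (KQ.P_nonneg _ _ _)
  · rw [← mul_div_assoc]
    refine div_le_div_of_nonneg_right ?_ hS
    have h := hcle n x qX hq0 hqD (fun i j hij => hmin ⟨i, j, hij, rfl⟩) (fun j => (α j : ℂ))
    rw [show -(1 - σ) * (2 * τ) = 2 * (σ * τ) - 2 * τ by ring]
    have h2 := mul_le_mul_of_nonneg_left h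
      (show 0 ≤ (2 * Real.pi) ^ (-(d : ℝ) / 2) by positivity)
    linarith
end
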